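/- arXiv:1002.4222 — 2 statements merged into one kernel-verified Lean document; each statement's English description precedes it below -/
import Mathlib

section
/- There exists an absolute constant C > 0 such that the following holds. Let n, m ≥ 2, let s ≥ 2, let v₁, …, v_m ∈ ℂ^n satisfy ‖v_i‖_∞ ≤ M for all i, let V be the n × m matrix with columns v_i, and let ε₁, …, ε_m be i.i.d. Rademacher random variables (taking values ±1 with probability 1/2). Then E ‖ Σ_{i=1}^m ε_i v_i v_i* ‖_s ≤ C · M · s^{1/2} · log s · √(log m · log n) · ‖V V*‖_s^{1/2}. -/
open MeasureTheory ProbabilityTheory Matrix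

/-- The `s`-norm of a square complex matrix: the supremum of `|y* A x|` over index
sets `Γ` of cardinality at most `s` and unit-`ℓ₂`-norm vectors `x, y` supported on `Γ`. -/
noncomputable def snormS {ι : Type*} [Fintype ι] (s : ℕ) (A : Matrix ι ι ℂ) : ℝ :=
  sSup {r : ℝ | ∃ (Γ : Finset ι) (x y : ι → ℂ),
    Γ.card ≤ s ∧ (∀ i, i ∉ Γ → x i = 0) ∧ (∀ i, i ∉ Γ → y i = 0) ∧
    (∑ i, ‖x i‖ ^ 2) = 1 ∧ (∑ i, ‖y i‖ ^ 2) = 1 ∧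
    r = ‖dotProduct (star y) (A.mulVec x)‖}

/-- The Rademacher law on `ℝ`: `±1` with probability `1/2` each. -/
noncomputable def rademacher : Measure ℝ :=
  (1 / 2 : ENNReal) • Measure.dirac (1 : ℝ) + (1 / 2 : ENNReal) • Measure.dirac (-1 : ℝ)

/-- Law of `m` i.i.d. Rademacher random variables. -/
noncomputable def rademacherPi (m : ℕ) : Measure (Fin m → ℝ) :=
  Measure.pi fun _ => rademacher


namespace RV

lemma rad_prob : IsProbabilityMeasure rademacher := by
  constructor
  simp [rademacher, ENNReal.inv_two_add_inv_two]

lemma rad_integrable (f : ℝ → ℝ) : Integrable f rademacher := by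
  unfold rademacher
  refine Integrable.add_measure ?_ ?_
  · exact (integrable_dirac (by simp)).smul_measure (by simp)
  · exact (integrable_dirac (by simp)).smul_measure (by simp)

lemma rad_integral (f : ℝ → ℝ) : ∫ t, f t ∂rademacher = (f 1 + f (-1)) / 2 := by
  unfold rademacher
  rw [integral_add_measure, integral_smul_measure, integral_smul_measure, integral_dirac,
    integral_dirac]
  · simp; ring
  · exact (integrable_dirac (by simp)).smul_measure (by simp)
  · exact (integrable_dirac (by simp)).smul_measure (by simp)

lemma exp_lin_integrable {m : ℕ} (a : Fin m → ℝ) :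
    Integrable (fun ε : Fin m → ℝ => Real.exp (∑ i, ε i * a i)) (rademacherPi m) := by
  have := rad_prob
  simp_rw [Real.exp_sum]
  unfold rademacherPi
  exact Integrable.fintype_prod (f := fun (i : Fin m) (t : ℝ) => Real.exp (t * a i))
    (fun i => rad_integrable _)

lemma exp_lin_integral {m : ℕ} (a : Fin m → ℝ) :
    ∫ ε : Fin m → ℝ, Real.exp (∑ i, ε i * a i) ∂(rademacherPi m)
      ≤ Real.exp ((∑ i, a i ^ 2) / 2) := by
  have := rad_prob
  simp_rw [Real.exp_sum]
  unfold rademacherPi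
  rw [integral_fintype_prod_eq_prod (f := fun (i : Fin m) (t : ℝ) => Real.exp (t * a i))]
  rw [Finset.sum_div, Real.exp_sum]
  refine Finset.prod_le_prod (fun i _ => integral_nonneg fun t => (Real.exp_pos _).le) ?_
  intro i _
  rw [rad_integral]
  have := Real.cosh_le_exp_half_sq (a i)
  rw [Real.cosh_eq] at this
  simpa using this

instance rad_pi_prob (m : ℕ) : IsProbabilityMeasure (rademacherPi m) := by
  have := rad_prob
  unfold rademacherPi
  infer_instance

/-- Subgaussian maximal inequality, in majorant form. -/
lemma max_majorant {m : ℕ} (F : Finset (Fin m → ℝ)) (σ L : ℝ) (hσ : 0 ≤ σ) (hL : 0 < L)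
    (hF : ∀ a ∈ F, ∑ i, a i ^ 2 ≤ σ ^ 2) (hcard : 2 * (F.card : ℝ) ≤ Real.exp L) :
    ∃ G : (Fin m → ℝ) → ℝ, Integrable G (rademacherPi m) ∧
      (∀ a ∈ F, ∀ ε, |∑ i, ε i * a i| ≤ G ε) ∧
      ∫ ε, G ε ∂(rademacherPi m) ≤ 2 * σ * √L := by
  rcases hσ.eq_or_lt with h0 | hpos
  · refine ⟨fun _ => 0, integrable_zero _ _ _, ?_, by simp [← h0]⟩
    intro a ha ε
    have h1 : ∑ i, a i ^ 2 ≤ 0 := by simpa [← h0] using hF a ha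
    have h2 : ∀ i, a i = 0 := by
      intro i
      have := (Finset.sum_eq_zero_iff_of_nonneg (fun i _ => sq_nonneg (a i))).1
        (le_antisymm h1 (Finset.sum_nonneg fun i _ => sq_nonneg (a i))) i (Finset.mem_univ i)
      simpa using this
    simp [h2]
  set l : ℝ := √L / σ with hl
  have hsL : 0 < √L := Real.sqrt_pos.2 hL
  have hlpos : 0 < l := div_pos hsL hpos
  set c : ℝ := 3 / 2 * L with hc
  let S : (Fin m → ℝ) → ℝ := fun ε => ∑ a ∈ F, (Real.exp (∑ i, ε i * (l * a i))
      + Real.exp (∑ i, ε i * (-(l * a i))))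
  have hSint : Integrable S (rademacherPi m) := by
    refine integrable_finsetSum _ fun a _ => ?_
    exact (exp_lin_integrable _).add (exp_lin_integrable _)
  have hSle : ∫ ε, S ε ∂(rademacherPi m) ≤ Real.exp c := by
    have h1 : ∫ ε, S ε ∂(rademacherPi m) ≤ ∑ a ∈ F, 2 * Real.exp (L / 2) := by
      simp only [S]
      rw [integral_finsetSum]
      swap
      · exact fun a _ => (exp_lin_integrable _).add (exp_lin_integrable _)
      refine Finset.sum_le_sum fun a ha => ?_
      rw [integral_add (exp_lin_integrable _) (exp_lin_integrable _)]
      have key : (∑ i, (l * a i) ^ 2) ≤ L := by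
        have : ∑ i, (l * a i) ^ 2 = l ^ 2 * ∑ i, a i ^ 2 := by
          rw [Finset.mul_sum]; exact Finset.sum_congr rfl fun i _ => by ring
        rw [this]
        calc l ^ 2 * ∑ i, a i ^ 2 ≤ l ^ 2 * σ ^ 2 := by
              gcongr; exact hF a ha
          _ = L := by
              rw [hl, div_pow, Real.sq_sqrt hL.le]; field_simp
      have e1 := exp_lin_integral (fun i => l * a i)
      have e2 := exp_lin_integral (fun i => -(l * a i))
      simp only [neg_sq] at e2
      have e3 : Real.exp ((∑ i, (l * a i) ^ 2) / 2) ≤ Real.exp (L / 2) :=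
        Real.exp_le_exp.2 (by linarith)
      linarith
    refine h1.trans ?_
    rw [Finset.sum_const, nsmul_eq_mul]
    have : Real.exp c = Real.exp L * Real.exp (L / 2) := by
      rw [← Real.exp_add]; congr 1; rw [hc]; ring
    rw [this]
    nlinarith [Real.exp_pos (L / 2)]
  refine ⟨fun ε => (1 / l) * (c - 1 + Real.exp (-c) * S ε), ?_, ?_, ?_⟩
  · exact ((integrable_const _).add (hSint.const_mul _)).const_mul _
  · intro a ha ε
    have hy : l * |∑ i, ε i * a i| ≤ c - 1 + Real.exp (-c) * S ε := by
      have h1 : Real.exp (l * |∑ i, ε i * a i|) ≤ S ε := by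
        have h2 : Real.exp (∑ i, ε i * (l * a i)) + Real.exp (∑ i, ε i * (-(l * a i))) ≤ S ε :=
          Finset.single_le_sum (f := fun a => Real.exp (∑ i, ε i * (l * a i))
            + Real.exp (∑ i, ε i * (-(l * a i)))) (fun a _ => by positivity) ha
        have h3 : ∑ i, ε i * (l * a i) = l * ∑ i, ε i * a i := by
          rw [Finset.mul_sum]; exact Finset.sum_congr rfl fun i _ => by ring
        have h4 : ∑ i, ε i * (-(l * a i)) = l * -∑ i, ε i * a i := by
          rw [← Finset.sum_neg_distrib, Finset.mul_sum]
          exact Finset.sum_congr rfl fun i _ => by ring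
        rw [h3, h4] at h2
        rcases abs_cases (∑ i, ε i * a i) with ⟨h, _⟩ | ⟨h, _⟩ <;> rw [h]
        · linarith [Real.exp_pos (l * -∑ i, ε i * a i)]
        · linarith [Real.exp_pos (l * ∑ i, ε i * a i)]
      have h5 := Real.add_one_le_exp (-c + l * |∑ i, ε i * a i|)
      rw [Real.exp_add] at h5
      have h6 := mul_le_mul_of_nonneg_left h1 (Real.exp_pos (-c)).le
      linarith
    show _ ≤ 1 / l * (c - 1 + Real.exp (-c) * S ε)
    rw [one_div, inv_mul_eq_div, le_div_iff₀ hlpos]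
    linarith
  · rw [integral_const_mul, integral_add (integrable_const _) (hSint.const_mul _),
      integral_const_mul]
    simp only [integral_const, probReal_univ, one_smul]
    have h6 := mul_le_mul_of_nonneg_left hSle (Real.exp_pos (-c)).le
    rw [← Real.exp_add, neg_add_cancel, Real.exp_zero] at h6
    have h7 : 1 / l * (c - 1 + Real.exp (-c) * ∫ ε, S ε ∂(rademacherPi m)) ≤ 1 / l * c := by
      gcongr; linarith
    refine h7.trans ?_
    have h8 : 1 / l * c = 3 / 2 * σ * √L := by
      rw [hl, hc, one_div_div]
      have : L = √L * √L := (Real.mul_self_sqrt hL.le).symm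
      field_simp
      nlinarith
    rw [h8]
    nlinarith [mul_pos hpos hsL]

end RV

namespace RV

lemma exp_le_add_exp_sq (u : ℝ) : Real.exp u ≤ u + Real.exp (u ^ 2) := by
  have h1 := Real.add_one_le_exp (u ^ 2)
  by_cases h : |u| ≤ 1
  · have := (abs_le.1 (Real.abs_exp_sub_one_sub_id_le h)).2
    linarith
  · push Not at h
    rcases lt_abs.1 h with h | h
    · have : Real.exp u ≤ Real.exp (u ^ 2) := Real.exp_le_exp.2 (by nlinarith)
      linarith
    · have : Real.exp u ≤ 1 := Real.exp_le_one_iff.2 (by linarith)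
      nlinarith

/-- Exponential moment bound for a centred bounded finite distribution. -/
lemma mgf_bound {ι : Type*} [Fintype ι] (θ t : ι → ℝ) (hθ : ∀ j, 0 ≤ θ j) (hsum : ∑ j, θ j = 1)
    (b l : ℝ) (ht : ∀ j, |t j| ≤ b) :
    ∑ j, θ j * Real.exp (l * (t j - ∑ j', θ j' * t j')) ≤ Real.exp (4 * l ^ 2 * b ^ 2) := by
  set tb := ∑ j', θ j' * t j' with htb
  have htbb : |tb| ≤ b := by
    calc |tb| ≤ ∑ j, |θ j * t j| := Finset.abs_sum_le_sum_abs _ _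
      _ ≤ ∑ j, θ j * b := Finset.sum_le_sum fun j _ => by
          rw [abs_mul, abs_of_nonneg (hθ j)]
          exact mul_le_mul_of_nonneg_left (ht j) (hθ j)
      _ = b := by rw [← Finset.sum_mul, hsum, one_mul]
  have h1 : ∀ j, θ j * Real.exp (l * (t j - tb)) ≤
      l * (θ j * t j) - l * tb * θ j + θ j * Real.exp (4 * l ^ 2 * b ^ 2) := by
    intro j
    have h2 := exp_le_add_exp_sq (l * (t j - tb))
    have h3 : (l * (t j - tb)) ^ 2 ≤ 4 * l ^ 2 * b ^ 2 := by
      have h4 : (t j - tb) ^ 2 ≤ (2 * b) ^ 2 := by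
        rw [sq_le_sq]
        have := abs_sub (t j) tb
        have := ht j
        have h0 : 0 ≤ b := (abs_nonneg _).trans htbb
        rw [abs_of_nonneg (by linarith : 0 ≤ 2 * b)]
        linarith
      nlinarith [sq_nonneg l]
    have h4 := Real.exp_le_exp.2 h3
    have h5 := mul_le_mul_of_nonneg_left (h2.trans (add_le_add_right h4 _)) (hθ j)
    nlinarith
  refine (Finset.sum_le_sum fun j _ => h1 j).trans ?_
  rw [Finset.sum_add_distrib, Finset.sum_sub_distrib, ← Finset.mul_sum, ← Finset.mul_sum,
    ← Finset.sum_mul, hsum]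
  simp only [← htb]
  linarith

lemma exists_le_of_avg {ι : Type*} [Fintype ι] (θ g : ι → ℝ) (hθ : ∀ j, 0 ≤ θ j)
    (hsum : ∑ j, θ j = 1) (B : ℝ) (h : ∑ j, θ j * g j ≤ B) : ∃ j, g j ≤ B := by
  by_contra hcon
  push Not at hcon
  have h1 : ∑ j, θ j * B < ∑ j, θ j * g j := by
    apply Finset.sum_lt_sum
    · intro j _
      exact mul_le_mul_of_nonneg_left (hcon j).le (hθ j)
    · by_contra h2
      push Not at h2
      have : ∀ j, θ j = 0 := by
        intro j
        by_contra hne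
        have hp : 0 < θ j := lt_of_le_of_ne (hθ j) (Ne.symm hne)
        have := h2 j (Finset.mem_univ j)
        nlinarith [hcon j]
      simp [this] at hsum
  rw [← Finset.sum_mul, hsum, one_mul] at h1
  linarith

/-- Greedy (derandomized) empirical method of Maurey. -/
lemma maurey_potential {ι κ : Type*} [Fintype ι] [Fintype κ] (θ : ι → ℝ) (t : κ → ι → ℝ)
    (hθ : ∀ j, 0 ≤ θ j) (hsum : ∑ j, θ j = 1) (b l : ℝ) (ht : ∀ k j, |t k j| ≤ b) (p : ℕ) :
    ∃ sel : Fin p → ι, ∑ k, Real.exp (l * (∑ q, (t k (sel q) - ∑ j, θ j * t k j)))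
      ≤ Fintype.card κ * Real.exp (4 * l ^ 2 * b ^ 2) ^ p := by
  induction p with
  | zero => exact ⟨fun q => q.elim0, by simp⟩
  | succ p ih =>
    obtain ⟨sel, hsel⟩ := ih
    set W : κ → ℝ := fun k => ∑ q, (t k (sel q) - ∑ j, θ j * t k j) with hW
    set E := Real.exp (4 * l ^ 2 * b ^ 2) with hE
    have : ∃ j0, ∑ k, Real.exp (l * W k) * Real.exp (l * (t k j0 - ∑ j, θ j * t k j))
        ≤ Fintype.card κ * E ^ p * E := by
      refine exists_le_of_avg θ _ hθ hsum _ ?_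
      calc ∑ j0, θ j0 * ∑ k, Real.exp (l * W k) * Real.exp (l * (t k j0 - ∑ j, θ j * t k j))
          = ∑ k, Real.exp (l * W k) *
              ∑ j0, θ j0 * Real.exp (l * (t k j0 - ∑ j, θ j * t k j)) := by
            simp_rw [Finset.mul_sum]
            rw [Finset.sum_comm]
            refine Finset.sum_congr rfl fun k _ => Finset.sum_congr rfl fun j _ => by ring
        _ ≤ ∑ k, Real.exp (l * W k) * E := by
            refine Finset.sum_le_sum fun k _ => ?_
            exact mul_le_mul_of_nonneg_left (mgf_bound θ (t k) hθ hsum b l (ht k))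
              (Real.exp_pos _).le
        _ ≤ Fintype.card κ * E ^ p * E := by
            rw [← Finset.sum_mul]
            exact mul_le_mul_of_nonneg_right hsel (Real.exp_pos _).le
    obtain ⟨j0, hj0⟩ := this
    refine ⟨Fin.snoc sel j0, ?_⟩
    rw [pow_succ, ← mul_assoc]
    refine le_trans (le_of_eq ?_) hj0
    refine Finset.sum_congr rfl fun k _ => ?_
    rw [← Real.exp_add, Fin.sum_univ_castSucc]
    simp only [Fin.snoc_castSucc, Fin.snoc_last, hW]
    congr 1; ring

lemma maurey {ι κ : Type*} [Fintype ι] [Fintype κ] (θ : ι → ℝ) (t : κ → ι → ℝ)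
    (hθ : ∀ j, 0 ≤ θ j) (hsum : ∑ j, θ j = 1) (b : ℝ) (hb : 0 < b) (ht : ∀ k j, |t k j| ≤ b)
    (p : ℕ) (hp : 0 < p) (L : ℝ) (hL : 0 < L) (hcard : (Fintype.card κ : ℝ) ≤ Real.exp L) :
    ∃ sel : Fin p → ι, ∀ k, (∑ q, t k (sel q)) / p - ∑ j, θ j * t k j ≤ 4 * b * √L / √p := by
  have hp' : (0 : ℝ) < p := by exact_mod_cast hp
  have hsp : 0 < √(p : ℝ) := Real.sqrt_pos.2 hp'
  have hsL : 0 < √L := Real.sqrt_pos.2 hL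
  set l : ℝ := √L / (2 * b * √p) with hl
  have hlp : 0 < l := by positivity
  obtain ⟨sel, hsel⟩ := maurey_potential θ t hθ hsum b l ht p
  refine ⟨sel, fun k => ?_⟩
  have h1 := Finset.single_le_sum
    (f := fun k => Real.exp (l * (∑ q, (t k (sel q) - ∑ j, θ j * t k j))))
    (fun _ _ => (Real.exp_pos _).le) (Finset.mem_univ k)
  have h2 : Real.exp (l * (∑ q, (t k (sel q) - ∑ j, θ j * t k j))) ≤
      Real.exp (L + p * (4 * l ^ 2 * b ^ 2)) := by
    rw [Real.exp_add, Real.exp_nat_mul]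
    exact (h1.trans hsel).trans (mul_le_mul_of_nonneg_right hcard (by positivity))
  have h3 := Real.exp_le_exp.1 h2
  rw [Finset.sum_sub_distrib] at h3
  simp only [Finset.sum_const, Finset.card_univ, Fintype.card_fin, nsmul_eq_mul] at h3
  have hLs : L = √L ^ 2 := (Real.sq_sqrt hL.le).symm
  have hps : (p : ℝ) = √(p : ℝ) ^ 2 := (Real.sq_sqrt hp'.le).symm
  have h4 : L + p * (4 * l ^ 2 * b ^ 2) = l * (4 * b * √L * √p) := by
    rw [hl]
    have : (p : ℝ) * (4 * (√L / (2 * b * √p)) ^ 2 * b ^ 2) = L := by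
      rw [div_pow, mul_pow, ← hps, ← hLs]; field_simp; norm_num
    rw [this]
    field_simp
    linarith
  rw [h4] at h3
  have h5 := le_of_mul_le_mul_left h3 hlp
  rw [div_sub' hp'.ne', div_le_div_iff₀ hp' hsp]
  calc _ ≤ (4 * b * √L * √p) * √p := mul_le_mul_of_nonneg_right h5 hsp.le
    _ = _ := by rw [mul_assoc, ← sq, ← hps]

lemma representative {V β : Type*} [Inhabited V] [DecidableEq V] [Fintype β]
    (T : Finset V) (z : V → β) :
    ∃ π : V → V, (∀ x ∈ T, π x ∈ T ∧ z (π x) = z x) ∧ (T.image π).card ≤ Fintype.card β := by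
  classical
  let r : β → V := fun b => if h : ∃ x ∈ T, z x = b then h.choose else default
  refine ⟨fun x => r (z x), ?_, ?_⟩
  · intro x hx
    have h : ∃ y ∈ T, z y = z x := ⟨x, hx, rfl⟩
    simp only [r, dif_pos h]
    exact h.choose_spec
  · have : T.image (fun x => r (z x)) ⊆ Finset.univ.image r := by
      intro y hy
      obtain ⟨x, _, rfl⟩ := Finset.mem_image.1 hy
      exact Finset.mem_image_of_mem _ (Finset.mem_univ _)
    exact (Finset.card_le_card this).trans Finset.card_image_le

end RV

namespace RV

/-- The pairing `v* x`. -/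
noncomputable def ip {n : ℕ} (v x : Fin n → ℂ) : ℂ := ∑ a, star (v a) * x a

/-- Squared Euclidean norm. -/
noncomputable def nsq {n : ℕ} (x : Fin n → ℂ) : ℝ := ∑ a, ‖x a‖ ^ 2

lemma nsq_nonneg {n : ℕ} (x : Fin n → ℂ) : 0 ≤ nsq x :=
  Finset.sum_nonneg fun _ _ => sq_nonneg _

lemma nsq_eq_zero {n : ℕ} (x : Fin n → ℂ) (h : nsq x = 0) : x = 0 := by
  funext a
  have := (Finset.sum_eq_zero_iff_of_nonneg (fun a _ => sq_nonneg (‖x a‖))).1 h a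
    (Finset.mem_univ a)
  simpa using this

lemma nsq_smul {n : ℕ} (c : ℂ) (x : Fin n → ℂ) : nsq (c • x) = ‖c‖ ^ 2 * nsq x := by
  simp [nsq, Finset.mul_sum, mul_pow]

lemma ip_add {n : ℕ} (v x y : Fin n → ℂ) : ip v (x + y) = ip v x + ip v y := by
  simp [ip, mul_add, Finset.sum_add_distrib]

lemma ip_sub {n : ℕ} (v x y : Fin n → ℂ) : ip v (x - y) = ip v x - ip v y := by
  simp [ip, mul_sub, Finset.sum_sub_distrib]

lemma ip_smul {n : ℕ} (v x : Fin n → ℂ) (c : ℂ) : ip v (c • x) = c * ip v x := by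
  simp only [ip, Finset.mul_sum, Pi.smul_apply, smul_eq_mul]
  exact Finset.sum_congr rfl fun a _ => by ring

lemma ip_zero {n : ℕ} (v : Fin n → ℂ) : ip v 0 = 0 := by simp [ip]

lemma quad_form {n m : ℕ} (v : Fin m → Fin n → ℂ) (c : Fin m → ℂ) (x y : Fin n → ℂ) :
    dotProduct (star y) ((∑ i, c i • Matrix.vecMulVec (v i) (star (v i))).mulVec x)
      = ∑ i, c i * (star (ip (v i) y) * ip (v i) x) := by
  rw [Matrix.sum_mulVec, dotProduct_sum]
  refine Finset.sum_congr rfl fun i _ => ?_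
  rw [Matrix.smul_mulVec, dotProduct_smul, Matrix.vecMulVec_mulVec, smul_eq_mul]
  congr 1
  simp only [ip, dotProduct, Pi.smul_apply, Pi.star_apply, MulOpposite.smul_eq_mul_unop,
    MulOpposite.unop_op, star_sum, star_mul, star_star]
  rw [Finset.sum_mul]
  refine Finset.sum_congr rfl fun a _ => ?_
  ring

lemma snorm_bdd {n : ℕ} (s : ℕ) (A : Matrix (Fin n) (Fin n) ℂ) :
    BddAbove {r : ℝ | ∃ (Γ : Finset (Fin n)) (x y : Fin n → ℂ),
    Γ.card ≤ s ∧ (∀ i, i ∉ Γ → x i = 0) ∧ (∀ i, i ∉ Γ → y i = 0) ∧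
    (∑ i, ‖x i‖ ^ 2) = 1 ∧ (∑ i, ‖y i‖ ^ 2) = 1 ∧
    r = ‖dotProduct (star y) (A.mulVec x)‖} := by
  refine ⟨∑ a, ∑ b, ‖A a b‖, ?_⟩
  rintro r ⟨Γ, x, y, -, -, -, hx, hy, rfl⟩
  have hle : ∀ z : Fin n → ℂ, ∑ i, ‖z i‖ ^ 2 = 1 → ∀ a, ‖z a‖ ≤ 1 := by
    intro z hz a
    have := Finset.single_le_sum (f := fun i => ‖z i‖ ^ 2) (fun i _ => sq_nonneg _)
      (Finset.mem_univ a)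
    simp only [hz] at this
    nlinarith [norm_nonneg (z a)]
  simp only [dotProduct, Matrix.mulVec]
  refine (norm_sum_le _ _).trans (Finset.sum_le_sum fun a _ => ?_)
  rw [norm_mul]
  have h1 : ‖star y a‖ ≤ 1 := by simpa using hle y hy a
  have h2 : ‖∑ b, A a b * x b‖ ≤ ∑ b, ‖A a b‖ := by
    refine (norm_sum_le _ _).trans (Finset.sum_le_sum fun b _ => ?_)
    rw [norm_mul]
    exact mul_le_of_le_one_right (norm_nonneg _) (hle x hx b)
  calc _ ≤ 1 * ∑ b, ‖A a b‖ := mul_le_mul h1 h2 (norm_nonneg _) zero_le_one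
    _ = _ := one_mul _

lemma snorm_nonneg {n : ℕ} (s : ℕ) (A : Matrix (Fin n) (Fin n) ℂ) : 0 ≤ snormS s A := by
  refine Real.sSup_nonneg ?_
  rintro r ⟨Γ, x, y, -, -, -, -, -, rfl⟩
  exact norm_nonneg _

lemma le_snorm {n : ℕ} (s : ℕ) (A : Matrix (Fin n) (Fin n) ℂ) (Γ : Finset (Fin n))
    (hΓ : Γ.card ≤ s) (x y : Fin n → ℂ) (hx : ∀ i, i ∉ Γ → x i = 0) (hy : ∀ i, i ∉ Γ → y i = 0) :
    ‖dotProduct (star y) (A.mulVec x)‖ ≤ snormS s A * √(nsq x) * √(nsq y) := by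
  rcases (nsq_nonneg x).eq_or_lt with h | hxp
  · have := nsq_eq_zero x h.symm
    subst this
    simp [← h]
  rcases (nsq_nonneg y).eq_or_lt with h | hyp
  · have := nsq_eq_zero y h.symm
    subst this
    simp [← h]
  set p := √(nsq x) with hp
  set q := √(nsq y) with hq
  have hpp : 0 < p := Real.sqrt_pos.2 hxp
  have hqp : 0 < q := Real.sqrt_pos.2 hyp
  have hps : p ^ 2 = nsq x := Real.sq_sqrt hxp.le
  have hqs : q ^ 2 = nsq y := Real.sq_sqrt hyp.le
  have key : ‖dotProduct (star (((q⁻¹ : ℝ) : ℂ) • y)) (A.mulVec (((p⁻¹ : ℝ) : ℂ) • x))‖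
      ≤ snormS s A := by
    refine le_csSup (snorm_bdd s A) ⟨Γ, _, _, hΓ, ?_, ?_, ?_, ?_, rfl⟩
    · intro i hi; simp [hx i hi]
    · intro i hi; simp [hy i hi]
    · have := nsq_smul ((p⁻¹ : ℝ) : ℂ) x
      rw [← hps] at this
      unfold nsq at this
      rw [this]
      simp [abs_of_pos hpp]
      field_simp
    · have := nsq_smul ((q⁻¹ : ℝ) : ℂ) y
      rw [← hqs] at this
      unfold nsq at this
      rw [this]
      simp [abs_of_pos hqp]
      field_simp
  rw [star_smul, smul_dotProduct, Matrix.mulVec_smul, dotProduct_smul, norm_smul, norm_smul] at key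
  simp only [norm_star, Complex.norm_real, Real.norm_eq_abs, abs_inv, abs_of_pos hpp,
    abs_of_pos hqp] at key
  rw [inv_mul_eq_div, inv_mul_eq_div, div_div, div_le_iff₀ (by positivity)] at key
  linarith

lemma snorm_le {n : ℕ} (s : ℕ) (A : Matrix (Fin n) (Fin n) ℂ) (B : ℝ) (hB : 0 ≤ B)
    (h : ∀ (Γ : Finset (Fin n)) (x y : Fin n → ℂ), Γ.card ≤ s → (∀ i, i ∉ Γ → x i = 0) →
      (∀ i, i ∉ Γ → y i = 0) → nsq x = 1 → nsq y = 1 →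
      ‖dotProduct (star y) (A.mulVec x)‖ ≤ B) : snormS s A ≤ B := by
  refine Real.sSup_le ?_ hB
  rintro r ⟨Γ, x, y, hΓ, hx, hy, hx1, hy1, rfl⟩
  exact h Γ x y hΓ hx hy hx1 hy1

lemma sum_ip_sq_le {n m : ℕ} (s : ℕ) (v : Fin m → Fin n → ℂ) (Γ : Finset (Fin n))
    (hΓ : Γ.card ≤ s) (x : Fin n → ℂ) (hx : ∀ i, i ∉ Γ → x i = 0) :
    ∑ i, ‖ip (v i) x‖ ^ 2 ≤ snormS s (∑ i, Matrix.vecMulVec (v i) (star (v i))) * nsq x := by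
  have h := le_snorm s (∑ i, Matrix.vecMulVec (v i) (star (v i))) Γ hΓ x x hx hx
  have h2 := quad_form v (fun _ => 1) x x
  simp only [one_smul, one_mul] at h2
  rw [h2, mul_assoc, Real.mul_self_sqrt (nsq_nonneg x)] at h
  refine le_trans (le_of_eq ?_) h
  have : ∑ i, star (ip (v i) x) * ip (v i) x = ((∑ i, ‖ip (v i) x‖ ^ 2 : ℝ) : ℂ) := by
    push_cast
    refine Finset.sum_congr rfl fun i _ => ?_
    exact Complex.conj_mul' _
  rw [this, Complex.norm_real, Real.norm_eq_abs, abs_of_nonneg]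
  exact Finset.sum_nonneg fun _ _ => sq_nonneg _

/-- The quadratic process. -/
noncomputable def Q {n m : ℕ} (v : Fin m → Fin n → ℂ) (ε : Fin m → ℝ) (x : Fin n → ℂ) : ℝ :=
  ∑ i, ε i * ‖ip (v i) x‖ ^ 2

lemma Q_form {n m : ℕ} (v : Fin m → Fin n → ℂ) (ε : Fin m → ℝ) (x : Fin n → ℂ) :
    dotProduct (star x) ((∑ i, (ε i : ℂ) • Matrix.vecMulVec (v i) (star (v i))).mulVec x)
      = (Q v ε x : ℂ) := by
  rw [quad_form]
  unfold Q
  push_cast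
  refine Finset.sum_congr rfl fun i _ => ?_
  congr 1
  exact Complex.conj_mul' _

lemma re_polar {n m : ℕ} (v : Fin m → Fin n → ℂ) (ε : Fin m → ℝ) (x y : Fin n → ℂ) :
    (dotProduct (star y) ((∑ i, (ε i : ℂ) • Matrix.vecMulVec (v i) (star (v i))).mulVec x)).re
      = Q v ε ((1 / 2 : ℂ) • (x + y)) - Q v ε ((1 / 2 : ℂ) • (x - y)) := by
  rw [quad_form, Complex.re_sum]
  unfold Q
  rw [← Finset.sum_sub_distrib]
  refine Finset.sum_congr rfl fun i _ => ?_
  rw [ip_smul, ip_smul, ip_add, ip_sub, Complex.re_ofReal_mul, ← mul_sub]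
  congr 1
  rw [norm_mul, norm_mul, mul_pow, mul_pow]
  simp only [← Complex.normSq_eq_norm_sq, Complex.normSq_apply]
  simp
  ring

lemma nsq_parallelogram {n : ℕ} (x y : Fin n → ℂ) :
    nsq ((1 / 2 : ℂ) • (x + y)) + nsq ((1 / 2 : ℂ) • (x - y)) = (nsq x + nsq y) / 2 := by
  rw [nsq_smul, nsq_smul]
  unfold nsq
  rw [← mul_add, ← Finset.sum_add_distrib, ← Finset.sum_add_distrib, Finset.mul_sum,
    Finset.sum_div]
  refine Finset.sum_congr rfl fun a _ => ?_
  simp only [Pi.add_apply, Pi.sub_apply, ← Complex.normSq_eq_norm_sq, Complex.normSq_apply]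
  simp
  ring

/-- Reduction from the `s`-norm to a quadratic form on an approximating set. -/
lemma snorm_le_of_net {n m : ℕ} (s : ℕ) (v : Fin m → Fin n → ℂ) (ε : Fin m → ℝ)
    (T : Set (Fin n → ℂ)) (g : ℝ) (hg0 : 0 ≤ g)
    (hT : ∀ (Γ : Finset (Fin n)) (z : Fin n → ℂ), Γ.card ≤ s → (∀ i, i ∉ Γ → z i = 0) →
      nsq z ≤ 1 → ∃ z' ∈ T, (∀ i, i ∉ Γ → z' i = 0) ∧ nsq z' ≤ 4 ∧ nsq (z - z') ≤ (1 / 40) ^ 2)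
    (hg : ∀ x ∈ T, |Q v ε x| ≤ g) :
    snormS s (∑ i, (ε i : ℂ) • Matrix.vecMulVec (v i) (star (v i))) ≤ 6 * g := by
  set A := ∑ i, (ε i : ℂ) • Matrix.vecMulVec (v i) (star (v i)) with hA
  set S := snormS s A with hS
  have hS0 : 0 ≤ S := snorm_nonneg s A
  have hQ : ∀ (Γ : Finset (Fin n)) (z : Fin n → ℂ), Γ.card ≤ s → (∀ i, i ∉ Γ → z i = 0) →
      nsq z ≤ 1 → |Q v ε z| ≤ g + 3 / 40 * S := by
    intro Γ z hΓ hz hz1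
    obtain ⟨z', hz'T, hz', hz'4, hd⟩ := hT Γ z hΓ hz hz1
    have hdz : ∀ i, i ∉ Γ → (z - z') i = 0 := fun i hi => by simp [hz i hi, hz' i hi]
    have e : (Q v ε z : ℂ) = (Q v ε z' : ℂ) + dotProduct (star (z - z')) (A.mulVec z)
        + dotProduct (star z') (A.mulVec (z - z')) := by
      rw [← Q_form, ← Q_form, star_sub, sub_dotProduct, Matrix.mulVec_sub, dotProduct_sub]
      ring
    have n1 := le_snorm s A Γ hΓ z (z - z') hz hdz
    have n2 := le_snorm s A Γ hΓ (z - z') z' hdz hz'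
    have s1 : √(nsq z) ≤ 1 := Real.sqrt_le_one.2 hz1
    have s2 : √(nsq z') ≤ 2 := by
      rw [Real.sqrt_le_left (by norm_num)]; linarith
    have s3 : √(nsq (z - z')) ≤ 1 / 40 := by
      rw [Real.sqrt_le_left (by norm_num)]; linarith
    have t1 : S * √(nsq z) * √(nsq (z - z')) ≤ S * 1 * (1 / 40) := by gcongr
    have t2 : S * √(nsq (z - z')) * √(nsq z') ≤ S * (1 / 40) * 2 := by gcongr
    have n3 : |Q v ε z| = ‖(Q v ε z : ℂ)‖ := by rw [Complex.norm_real, Real.norm_eq_abs]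
    have n4 : |Q v ε z'| = ‖(Q v ε z' : ℂ)‖ := by rw [Complex.norm_real, Real.norm_eq_abs]
    have n5 := hg z' hz'T
    rw [n3, e]
    rw [n4] at n5
    refine (norm_add₃_le).trans ?_
    linarith
  have hre : ∀ (Γ : Finset (Fin n)) (x y : Fin n → ℂ), Γ.card ≤ s → (∀ i, i ∉ Γ → x i = 0) →
      (∀ i, i ∉ Γ → y i = 0) → nsq x = 1 → nsq y = 1 →
      |(dotProduct (star y) (A.mulVec x)).re| ≤ 2 * (g + 3 / 40 * S) := by
    intro Γ x y hΓ hx hy hx1 hy1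
    have hp := nsq_parallelogram x y
    rw [hx1, hy1] at hp
    have p1 := nsq_nonneg ((1 / 2 : ℂ) • (x + y))
    have p2 := nsq_nonneg ((1 / 2 : ℂ) • (x - y))
    have q1 := hQ Γ ((1 / 2 : ℂ) • (x + y)) hΓ (fun i hi => by simp [hx i hi, hy i hi])
      (by linarith)
    have q2 := hQ Γ ((1 / 2 : ℂ) • (x - y)) hΓ (fun i hi => by simp [hx i hi, hy i hi])
      (by linarith)
    rw [re_polar]
    refine (abs_sub _ _).trans ?_
    linarith
  have hfin : S ≤ 4 * (g + 3 / 40 * S) := by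
    refine snorm_le s A _ (by positivity) ?_
    intro Γ x y hΓ hx hy hx1 hy1
    have r1 := hre Γ x y hΓ hx hy hx1 hy1
    have r2 := hre Γ (-Complex.I • x) y hΓ (fun i hi => by simp [hx i hi]) hy
      (by rw [nsq_smul]; simp [hx1]) hy1
    rw [Matrix.mulVec_smul, dotProduct_smul] at r2
    have : (-Complex.I • dotProduct (star y) (A.mulVec x)).re
      = (dotProduct (star y) (A.mulVec x)).im := by simp
    rw [this] at r2
    refine (Complex.norm_le_abs_re_add_abs_im _).trans ?_
    linarith
  linarith

end RV

namespace RV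

/-- Positive parts in the four coordinate directions. -/
noncomputable def pp (z : ℂ) : Fin 4 → ℝ := ![max z.re 0, max z.im 0, max (-z.re) 0, max (-z.im) 0]

lemma pp_nonneg (z : ℂ) (c : Fin 4) : 0 ≤ pp z c := by
  fin_cases c <;> simp [pp]

lemma max_neg_sub (r : ℝ) : max r 0 - max (-r) 0 = r := by
  rcases le_total r 0 with h | h
  · rw [max_eq_right h, max_eq_left (by linarith)]; ring
  · rw [max_eq_left h, max_eq_right (by linarith)]; ring

lemma max_neg_add (r : ℝ) : max r 0 + max (-r) 0 = |r| := by
  rcases le_total r 0 with h | h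
  · rw [max_eq_right h, max_eq_left (by linarith), abs_of_nonpos h]; ring
  · rw [max_eq_left h, max_eq_right (by linarith), abs_of_nonneg h]; ring

lemma pp_sum (z : ℂ) : ∑ c, pp z c = |z.re| + |z.im| := by
  have h1 := max_neg_add z.re
  have h2 := max_neg_add z.im
  rw [Fin.sum_univ_four]
  simp only [pp, Matrix.cons_val]
  linarith

lemma pp_recon (z : ℂ) : ∑ c : Fin 4, (pp z c : ℂ) * Complex.I ^ (c : ℕ) = z := by
  rw [Fin.sum_univ_four]
  have h1 := max_neg_sub z.re
  have h2 := max_neg_sub z.im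
  apply Complex.ext
  · simp [pp, pow_succ]; linarith
  · simp [pp, pow_succ]; linarith

/-- Covering by Maurey's empirical method. -/
lemma cover {n m : ℕ} (hm : 2 ≤ m) (v : Fin m → Fin n → ℂ) (M ρ : ℝ) (hM : 0 < M) (hρ : 0 < ρ)
    (hv : ∀ i a, ‖v i a‖ ≤ M) (T : Finset (Fin n → ℂ))
    (hT : ∀ x ∈ T, ∑ a, (|(x a).re| + |(x a).im|) ≤ ρ) (p : ℕ) (hp : 0 < p) :
    ∃ π : (Fin n → ℂ) → (Fin n → ℂ), (∀ x ∈ T, π x ∈ T ∧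
      ∀ i, ‖ip (v i) x - ip (v i) (π x)‖ ≤ 32 * ρ * M * √(Real.log m) / √p) ∧
      (T.image π).card ≤ (4 * n + 1) ^ p := by
  classical
  let t : (Fin m × Fin 4) → Option (Fin n × Fin 4) → ℝ := fun k j => match j with
    | none => 0
    | some ac => ρ * (Complex.I ^ (k.2 : ℕ) * (Complex.I ^ (ac.2 : ℕ) * star (v k.1 ac.1))).re
  have hlogm : 0 < Real.log m := Real.log_pos (by exact_mod_cast hm)
  have htb : ∀ k j, |t k j| ≤ ρ * M := by
    intro k j
    rcases j with _ | ⟨a, c⟩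
    · simp [t]; positivity
    · simp only [t]
      rw [abs_mul, abs_of_pos hρ]
      refine mul_le_mul_of_nonneg_left ((Complex.abs_re_le_norm _).trans ?_) hρ.le
      simpa using hv k.1 a
  have hcard : (Fintype.card (Fin m × Fin 4) : ℝ) ≤ Real.exp (3 * Real.log m) := by
    have hm' : (2 : ℝ) ≤ m := by exact_mod_cast hm
    have : Real.exp (3 * Real.log m) = (m : ℝ) ^ 3 := by
      rw [mul_comm, Real.exp_mul, Real.exp_log (by linarith)]
      norm_cast
    rw [this]
    simp only [Fintype.card_prod, Fintype.card_fin]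
    push_cast
    have h4 : (4 : ℝ) ≤ m ^ 2 := by nlinarith
    nlinarith
  set B := 4 * (ρ * M) * √(3 * Real.log m) / √p with hB
  have hx : ∀ x ∈ T, ∃ sel : Fin p → Option (Fin n × Fin 4), ∀ k : Fin m × Fin 4,
      (∑ q, t k (sel q)) / p - (Complex.I ^ (k.2 : ℕ) * ip (v k.1) x).re ≤ B := by
    intro x hxT
    let θ : Option (Fin n × Fin 4) → ℝ := fun j => match j with
      | none => 1 - (∑ a, (|(x a).re| + |(x a).im|)) / ρ
      | some ac => pp (x ac.1) ac.2 / ρ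
    have hθ : ∀ j, 0 ≤ θ j := by
      intro j
      rcases j with _ | ⟨a, c⟩
      · simp only [θ]
        rw [sub_nonneg, div_le_one hρ]
        exact hT x hxT
      · exact div_nonneg (pp_nonneg _ _) hρ.le
    have hsum : ∑ j, θ j = 1 := by
      rw [Fintype.sum_option, Fintype.sum_prod_type]
      simp only [θ]
      simp_rw [← Finset.sum_div, pp_sum]
      ring
    obtain ⟨sel, hsel⟩ := maurey θ t hθ hsum (ρ * M) (by positivity) htb p hp (3 * Real.log m)
      (by positivity) hcard
    refine ⟨sel, fun k => ?_⟩
    have e : ∑ j, θ j * t k j = (Complex.I ^ (k.2 : ℕ) * ip (v k.1) x).re := by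
      rw [Fintype.sum_option, Fintype.sum_prod_type]
      simp only [θ, t, mul_zero, zero_add, ip]
      rw [Finset.mul_sum, Complex.re_sum]
      refine Finset.sum_congr rfl fun a _ => ?_
      conv_rhs => rw [← pp_recon (x a)]
      rw [Finset.mul_sum, Finset.mul_sum, Complex.re_sum]
      refine Finset.sum_congr rfl fun c _ => ?_
      rw [← mul_assoc, div_mul_cancel₀ _ hρ.ne', ← Complex.re_ofReal_mul]
      congr 1
      ring
    rw [← e]
    exact hsel k
  choose! z hz using hx
  obtain ⟨π, h1, h2⟩ := representative T z
  refine ⟨π, fun x hxT => ⟨(h1 x hxT).1, fun i => ?_⟩, ?_⟩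
  · obtain ⟨hπT, hzz⟩ := h1 x hxT
    have a1 := hz x hxT
    have a2 := hz (π x) hπT
    rw [hzz] at a2
    have b0 := a1 (i, 0)
    have b1 := a1 (i, 1)
    have b2 := a1 (i, 2)
    have b3 := a1 (i, 3)
    have c0 := a2 (i, 0)
    have c1 := a2 (i, 1)
    have c2 := a2 (i, 2)
    have c3 := a2 (i, 3)
    have tneg : ∀ (r r' : Fin 4), Complex.I ^ (r' : ℕ) = - Complex.I ^ (r : ℕ) →
        ∑ q, t (i, r') (z x q) = - ∑ q, t (i, r) (z x q) := by
      intro r r' h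
      rw [← Finset.sum_neg_distrib]
      refine Finset.sum_congr rfl fun q _ => ?_
      rcases z x q with _ | ⟨a, c⟩
      · simp [t]
      · simp only [t]
        rw [h, neg_mul, Complex.neg_re]; ring
    have t2 := tneg 0 2 (by simp)
    have t3 := tneg 1 3 (by simp [pow_succ])
    rw [t2, neg_div] at b2 c2
    rw [t3, neg_div] at b3 c3
    simp [pow_succ] at b0 b1 b2 b3 c0 c1 c2 c3
    have hre : |(ip (v i) x - ip (v i) (π x)).re| ≤ 2 * B := by
      rw [Complex.sub_re, abs_le]; constructor <;> linarith
    have him : |(ip (v i) x - ip (v i) (π x)).im| ≤ 2 * B := by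
      rw [Complex.sub_im, abs_le]; constructor <;> linarith
    refine (Complex.norm_le_abs_re_add_abs_im _).trans ?_
    have hs3 : √(3 * Real.log m) ≤ 2 * √(Real.log m) := by
      rw [Real.sqrt_mul (by norm_num)]
      refine mul_le_mul_of_nonneg_right ?_ (Real.sqrt_nonneg _)
      rw [Real.sqrt_le_left (by norm_num)]; norm_num
    have hBle : B ≤ 4 * (ρ * M) * (2 * √(Real.log m)) / √p := by
      rw [hB]; gcongr
    have : 32 * ρ * M * √(Real.log m) / √p = 4 * (4 * (ρ * M) * (2 * √(Real.log m)) / √p) := by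
      ring
    rw [this]
    linarith
  · refine h2.trans (le_of_eq ?_)
    simp [Fintype.card_option, Fintype.card_prod]
    ring

/-- A finite grid net of the sparse unit vectors. -/
lemma exists_net (n s : ℕ) (hs : 2 ≤ s) (hn : 2 ≤ n) :
    ∃ T : Finset (Fin n → ℂ), (0 : Fin n → ℂ) ∈ T ∧
      T.card ≤ n ^ s * ((80 * s + 1) * (80 * s + 1)) ^ s ∧
      (∀ x ∈ T, nsq x ≤ 4 ∧ ∃ Γ : Finset (Fin n), Γ.card ≤ s ∧ ∀ i, i ∉ Γ → x i = 0) ∧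
      (∀ (Γ : Finset (Fin n)) (z : Fin n → ℂ), Γ.card ≤ s → (∀ i, i ∉ Γ → z i = 0) →
        nsq z ≤ 1 → ∃ z' ∈ T, (∀ i, i ∉ Γ → z' i = 0) ∧ nsq z' ≤ 4 ∧
          nsq (z - z') ≤ (1 / 40) ^ 2) := by
  classical
  set N : ℕ := 40 * s with hN
  have hs' : (2 : ℝ) ≤ s := by exact_mod_cast hs
  have hNr : (N : ℝ) = 40 * s := by rw [hN]; push_cast; ring
  have hNpos : (0 : ℝ) < N := by rw [hNr]; linarith
  let I0 : Finset ℤ := Finset.Icc (-(N : ℤ)) N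
  let pt : ℤ × ℤ → ℂ := fun q => ⟨(q.1 : ℝ) / N, (q.2 : ℝ) / N⟩
  let G : Finset ℂ := (I0 ×ˢ I0).image pt
  have hGcard : G.card ≤ (80 * s + 1) * (80 * s + 1) := by
    refine Finset.card_image_le.trans (le_of_eq ?_)
    rw [Finset.card_product]
    have : I0.card = 80 * s + 1 := by
      simp only [I0, Int.card_Icc]; omega
    rw [this]
  have h0G : (0 : ℂ) ∈ G := by
    refine Finset.mem_image.2 ⟨(0, 0), ?_, ?_⟩
    · simp [I0]
    · apply Complex.ext <;> simp [pt]
  have hGpos : 1 ≤ G.card := Finset.card_pos.2 ⟨0, h0G⟩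
  let P : (Fin s → Fin n) → Finset (Fin n → ℂ) := fun f =>
    (Fintype.piFinset (fun a => if a ∈ Finset.univ.image f then G else {0}))
  let T : Finset (Fin n → ℂ) := (Finset.univ.biUnion P).filter (fun x => nsq x ≤ 4)
  have hmemT : ∀ x, x ∈ T ↔ (∃ f : Fin s → Fin n,
      ∀ a, x a ∈ (if a ∈ Finset.univ.image f then G else {0} : Finset ℂ)) ∧ nsq x ≤ 4 := by
    intro x
    simp only [T, P, Finset.mem_filter, Finset.mem_biUnion, Finset.mem_univ, true_and,
      Fintype.mem_piFinset]
  have hn0 : 0 < n := by omega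
  refine ⟨T, ?_, ?_, ?_, ?_⟩
  · rw [hmemT]
    refine ⟨⟨fun _ => ⟨0, hn0⟩, fun a => ?_⟩, by simp [nsq]⟩
    split_ifs
    · exact h0G
    · simp
  · refine (Finset.card_filter_le _ _).trans (Finset.card_biUnion_le.trans ?_)
    have : ∀ f ∈ (Finset.univ : Finset (Fin s → Fin n)),
        (P f).card ≤ ((80 * s + 1) * (80 * s + 1)) ^ s := by
      intro f _
      simp only [P, Fintype.card_piFinset]
      have e : ∀ a, (if a ∈ Finset.univ.image f then G else ({0} : Finset ℂ)).card
          = if a ∈ Finset.univ.image f then G.card else 1 := by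
        intro a; split_ifs <;> simp
      simp_rw [e]
      rw [Finset.prod_ite_mem, Finset.univ_inter, Finset.prod_const]
      have hc : (Finset.univ.image f).card ≤ s := by
        simpa using (Finset.card_image_le (s := Finset.univ) (f := f))
      exact (Nat.pow_le_pow_right hGpos hc).trans (Nat.pow_le_pow_left hGcard s)
    refine (Finset.sum_le_card_nsmul _ _ _ this).trans (le_of_eq ?_)
    simp
  · intro x hx
    obtain ⟨⟨f, hf⟩, h4⟩ := (hmemT x).1 hx
    refine ⟨h4, Finset.univ.image f, ?_, ?_⟩
    · simpa using (Finset.card_image_le (s := Finset.univ) (f := f))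
    · intro i hi
      have := hf i
      rw [if_neg hi] at this
      simpa using this
  · intro Γ z hΓ hz hz1
    let rd : ℂ → ℂ := fun w => pt (⌊(N : ℝ) * w.re⌋, ⌊(N : ℝ) * w.im⌋)
    have hrd0 : rd 0 = 0 := by
      apply Complex.ext <;> simp [rd, pt]
    have hfl : ∀ r : ℝ, |r - (⌊(N : ℝ) * r⌋ : ℝ) / N| ≤ 1 / N := by
      intro r
      have h1 := Int.floor_le ((N : ℝ) * r)
      have h2 := Int.lt_floor_add_one ((N : ℝ) * r)
      have e : r - (⌊(N : ℝ) * r⌋ : ℝ) / N = (N * r - ⌊(N : ℝ) * r⌋) / N := by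
        field_simp
      rw [e, abs_of_nonneg (div_nonneg (by linarith) hNpos.le)]
      gcongr
      linarith
    have hrd : ∀ w, ‖w - rd w‖ ^ 2 ≤ 2 / (N : ℝ) ^ 2 := by
      intro w
      rw [← Complex.normSq_eq_norm_sq, Complex.normSq_apply]
      have h1 : (w - rd w).re ^ 2 ≤ (1 / (N : ℝ)) ^ 2 := by
        rw [sq_le_sq, abs_of_pos (by positivity : 0 < 1 / (N : ℝ))]
        exact hfl w.re
      have h2 : (w - rd w).im ^ 2 ≤ (1 / (N : ℝ)) ^ 2 := by
        rw [sq_le_sq, abs_of_pos (by positivity : 0 < 1 / (N : ℝ))]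
        exact hfl w.im
      have e : 2 / (N : ℝ) ^ 2 = (1 / (N : ℝ)) ^ 2 + (1 / (N : ℝ)) ^ 2 := by ring
      rw [e]
      nlinarith
    have hza : ∀ a, ‖z a‖ ≤ 1 := by
      intro a
      have := Finset.single_le_sum (f := fun i => ‖z i‖ ^ 2) (fun i _ => sq_nonneg _)
        (Finset.mem_univ a)
      have h2 : ‖z a‖ ^ 2 ≤ 1 := this.trans hz1
      nlinarith [norm_nonneg (z a)]
    have hI : ∀ r : ℝ, |r| ≤ 1 → ⌊(N : ℝ) * r⌋ ∈ I0 := by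
      intro r hr
      obtain ⟨l, u⟩ := abs_le.1 hr
      refine Finset.mem_Icc.2 ⟨?_, ?_⟩
      · rw [Int.le_floor]; push_cast; nlinarith
      · have : ((⌊(N : ℝ) * r⌋ : ℤ) : ℝ) ≤ ((N : ℤ) : ℝ) := by
          refine (Int.floor_le _).trans ?_
          push_cast; nlinarith
        exact_mod_cast this
    have hdist : nsq (z - fun a => rd (z a)) ≤ (1 / 40) ^ 2 := by
      have h1 : nsq (z - fun a => rd (z a)) = ∑ a ∈ Γ, ‖z a - rd (z a)‖ ^ 2 := by
        unfold nsq
        symm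
        refine Finset.sum_subset (Finset.subset_univ _) ?_
        intro a _ ha
        simp [hz a ha, hrd0]
      rw [h1]
      refine (Finset.sum_le_card_nsmul _ _ _ (fun a _ => hrd (z a))).trans ?_
      rw [nsmul_eq_mul, hNr]
      have hΓ' : (Γ.card : ℝ) ≤ s := by exact_mod_cast hΓ
      calc (Γ.card : ℝ) * (2 / (40 * (s : ℝ)) ^ 2) ≤ (s : ℝ) * (2 / (40 * (s : ℝ)) ^ 2) := by
            gcongr
        _ = (2 / (s : ℝ)) * (1 / 40) ^ 2 := by field_simp
        _ ≤ (1 : ℝ) * (1 / 40) ^ 2 := by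
            gcongr
            rw [div_le_one (by linarith)]; exact hs'
        _ = _ := one_mul _
    have h4 : nsq (fun a => rd (z a)) ≤ 4 := by
      have : nsq (fun a => rd (z a)) ≤ 2 * nsq z + 2 * nsq (z - fun a => rd (z a)) := by
        unfold nsq
        rw [Finset.mul_sum, Finset.mul_sum, ← Finset.sum_add_distrib]
        refine Finset.sum_le_sum fun a _ => ?_
        have h := norm_sub_le (z a) (z a - rd (z a))
        rw [sub_sub_cancel] at h
        simp only [Pi.sub_apply]
        nlinarith [norm_nonneg (rd (z a)), sq_nonneg (‖z a‖ - ‖z a - rd (z a)‖)]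
      norm_num at hdist
      linarith
    have hsupp : ∀ i, i ∉ Γ → rd (z i) = 0 := fun i hi => by rw [hz i hi, hrd0]
    refine ⟨fun a => rd (z a), ?_, hsupp, h4, hdist⟩
    rw [hmemT]
    refine ⟨?_, h4⟩
    have hf : ∃ f : Fin s → Fin n, Γ ⊆ Finset.univ.image f := by
      refine ⟨fun j => if h : (j : ℕ) < Γ.card then (Γ.equivFin.symm ⟨j, h⟩ : Fin n)
        else ⟨0, hn0⟩, ?_⟩
      intro a ha
      refine Finset.mem_image.2 ⟨⟨Γ.equivFin ⟨a, ha⟩, ?_⟩, Finset.mem_univ _, ?_⟩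
      · exact lt_of_lt_of_le (Γ.equivFin ⟨a, ha⟩).2 hΓ
      · simp
    obtain ⟨f, hf⟩ := hf
    refine ⟨f, fun a => ?_⟩
    split_ifs with h
    · refine Finset.mem_image.2 ⟨(⌊(N : ℝ) * (z a).re⌋, ⌊(N : ℝ) * (z a).im⌋), ?_, rfl⟩
      exact Finset.mem_product.2 ⟨hI _ ((Complex.abs_re_le_norm _).trans (hza a)),
        hI _ ((Complex.abs_im_le_norm _).trans (hza a))⟩
    · rw [hsupp a (fun h' => h (hf h'))]; simp

lemma l1_le {n s : ℕ} (x : Fin n → ℂ) (Γ : Finset (Fin n)) (hΓ : Γ.card ≤ s)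
    (hx : ∀ i, i ∉ Γ → x i = 0) (h4 : nsq x ≤ 4) :
    ∑ a, (|(x a).re| + |(x a).im|) ≤ 4 * √s := by
  have h1 : ∑ a, (|(x a).re| + |(x a).im|) ≤ 2 * ∑ a ∈ Γ, ‖x a‖ := by
    rw [← Finset.sum_subset (Finset.subset_univ Γ) (fun a _ ha => by simp [hx a ha]),
      Finset.mul_sum]
    refine Finset.sum_le_sum fun a _ => ?_
    linarith [Complex.abs_re_le_norm (x a), Complex.abs_im_le_norm (x a)]
  have h2 : (∑ a ∈ Γ, ‖x a‖) ^ 2 ≤ (2 * √s) ^ 2 := by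
    refine (sq_sum_le_card_mul_sum_sq).trans ?_
    have h3 : ∑ a ∈ Γ, ‖x a‖ ^ 2 ≤ 4 :=
      (Finset.sum_le_sum_of_subset_of_nonneg (Finset.subset_univ Γ)
        (fun _ _ _ => sq_nonneg _)).trans h4
    have hΓ' : (Γ.card : ℝ) ≤ s := by exact_mod_cast hΓ
    rw [mul_pow, Real.sq_sqrt (Nat.cast_nonneg s)]
    have : (0 : ℝ) ≤ ∑ a ∈ Γ, ‖x a‖ ^ 2 := Finset.sum_nonneg fun _ _ => sq_nonneg _
    nlinarith
  have h3 := abs_le_of_sq_le_sq h2 (by positivity)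
  linarith [le_abs_self (∑ a ∈ Γ, ‖x a‖)]

end RV

namespace RV

lemma incr {m : ℕ} (α β : Fin m → ℂ) (d r : ℝ) (hd : ∀ i, ‖α i - β i‖ ≤ d) (hr : 0 ≤ r)
    (hα : ∑ i, ‖α i‖ ^ 2 ≤ r * 4) (hβ : ∑ i, ‖β i‖ ^ 2 ≤ r * 4) :
    ∑ i, (‖α i‖ ^ 2 - ‖β i‖ ^ 2) ^ 2 ≤ (4 * √r * d) ^ 2 := by
  have h1 : ∀ i, (‖α i‖ ^ 2 - ‖β i‖ ^ 2) ^ 2 ≤ d ^ 2 * (2 * ‖α i‖ ^ 2 + 2 * ‖β i‖ ^ 2) := by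
    intro i
    have h2 := (abs_norm_sub_norm_le (α i) (β i)).trans (hd i)
    have h3 : (‖α i‖ - ‖β i‖) ^ 2 ≤ d ^ 2 := by
      rw [← sq_abs]
      exact pow_le_pow_left₀ (abs_nonneg _) h2 2
    have h4 : (‖α i‖ ^ 2 - ‖β i‖ ^ 2) ^ 2 = (‖α i‖ - ‖β i‖) ^ 2 * (‖α i‖ + ‖β i‖) ^ 2 := by ring
    rw [h4]
    refine mul_le_mul h3 ?_ (sq_nonneg _) (sq_nonneg _)
    nlinarith [sq_nonneg (‖α i‖ - ‖β i‖)]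
  refine (Finset.sum_le_sum fun i _ => h1 i).trans ?_
  rw [← Finset.mul_sum, Finset.sum_add_distrib, ← Finset.mul_sum, ← Finset.mul_sum]
  have : (4 * √r * d) ^ 2 = d ^ 2 * (16 * r) := by
    rw [mul_pow, mul_pow, Real.sq_sqrt hr]; ring
  rw [this]
  refine mul_le_mul_of_nonneg_left ?_ (sq_nonneg _)
  linarith

lemma ip_norm_le {n : ℕ} (v x : Fin n → ℂ) (M : ℝ) (hv : ∀ a, ‖v a‖ ≤ M) :
    ‖ip v x‖ ≤ M * ∑ a, (|(x a).re| + |(x a).im|) := by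
  unfold ip
  rw [Finset.mul_sum]
  refine (norm_sum_le _ _).trans (Finset.sum_le_sum fun a _ => ?_)
  rw [norm_mul, norm_star]
  exact mul_le_mul (hv a) (Complex.norm_le_abs_re_add_abs_im _) (norm_nonneg _)
    ((norm_nonneg _).trans (hv a))

lemma card_bound_net (n s : ℕ) (hn : 2 ≤ n) (hs : 2 ≤ s) :
    2 * (n ^ s * ((80 * s + 1) * (80 * s + 1)) ^ s) ≤ n ^ (10 * s ^ 2) := by
  have h1 : 80 * s + 1 ≤ 2 ^ (7 + s) := by
    have : s < 2 ^ s := Nat.lt_two_pow_self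
    rw [pow_add]; omega
  have h2 : 2 ^ (7 + s) ≤ n ^ (7 + s) := Nat.pow_le_pow_left hn _
  have h3 : 80 * s + 1 ≤ n ^ (7 + s) := h1.trans h2
  calc 2 * (n ^ s * ((80 * s + 1) * (80 * s + 1)) ^ s)
      ≤ n * (n ^ s * (n ^ (7 + s) * n ^ (7 + s)) ^ s) := by gcongr
    _ = n ^ (1 + s + (14 + 2 * s) * s) := by ring
    _ ≤ n ^ (10 * s ^ 2) := by
        refine Nat.pow_le_pow_right (by omega) ?_
        nlinarith

lemma card_bound_level (n k : ℕ) (hn : 2 ≤ n) :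
    2 * ((4 * n + 1) ^ (4 ^ k) * (4 * n + 1) ^ (4 ^ (k + 1))) ≤ n ^ (21 * 4 ^ k) := by
  have h1 : 4 * n + 1 ≤ n ^ 4 := by
    have : 2 ^ 3 ≤ n ^ 3 := Nat.pow_le_pow_left hn 3
    calc 4 * n + 1 ≤ 2 ^ 3 * n := by omega
      _ ≤ n ^ 3 * n := Nat.mul_le_mul_right _ this
      _ = n ^ 4 := by ring
  have h4 : 1 ≤ 4 ^ k := Nat.one_le_pow _ _ (by norm_num)
  calc 2 * ((4 * n + 1) ^ (4 ^ k) * (4 * n + 1) ^ (4 ^ (k + 1)))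
      ≤ n * ((n ^ 4) ^ (4 ^ k) * (n ^ 4) ^ (4 ^ (k + 1))) := by gcongr
    _ = n ^ (1 + 20 * 4 ^ k) := by
        rw [← pow_add, ← pow_mul, pow_succ 4 k]; ring
    _ ≤ n ^ (21 * 4 ^ k) := Nat.pow_le_pow_right (by omega) (by omega)

lemma cast_pow_exp (n N : ℕ) (hn : 2 ≤ n) : ((n ^ N : ℕ) : ℝ) = Real.exp (N * Real.log n) := by
  have : (0 : ℝ) < n := by exact_mod_cast (by omega : 0 < n)
  rw [Real.exp_nat_mul, Real.exp_log this]
  push_cast; rfl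

/-- The chain of approximations. -/
lemma exists_chain {n m s : ℕ} (hm : 2 ≤ m) (hs : 2 ≤ s) (v : Fin m → Fin n → ℂ) (M : ℝ)
    (hM : 0 < M) (hv : ∀ i a, ‖v i a‖ ≤ M) (T : Finset (Fin n → ℂ)) (h0 : (0 : Fin n → ℂ) ∈ T)
    (hT : ∀ x ∈ T, ∑ a, (|(x a).re| + |(x a).im|) ≤ 4 * √s) :
    ∃ π : ℕ → (Fin n → ℂ) → (Fin n → ℂ), (∀ x, π 0 x = 0) ∧ (∀ k, ∀ x ∈ T, π k x ∈ T ∧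
      ∀ i, ‖ip (v i) x - ip (v i) (π k x)‖ ≤ 128 * M * √s * √(Real.log m) / 2 ^ k) ∧
      ∀ k, (T.image (π k)).card ≤ (4 * n + 1) ^ (4 ^ k) := by
  have hspos : (0 : ℝ) < √s := Real.sqrt_pos.2 (by exact_mod_cast (by omega : 0 < s))
  have hc := fun k : ℕ => cover hm v M (4 * √s) hM (by positivity) hv T hT (4 ^ k) (by positivity)
  choose π h1 h2 using hc
  refine ⟨fun k => if k = 0 then fun _ => 0 else π k, by simp, ?_, ?_⟩
  · intro k x hx
    by_cases hk : k = 0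
    · subst hk
      refine ⟨by simpa using h0, fun i => ?_⟩
      simp only [if_true, ip_zero, sub_zero, pow_zero, div_one]
      have a1 := ip_norm_le (v i) x M (hv i)
      have a2 := mul_le_mul_of_nonneg_left (hT x hx) hM.le
      have a3 : (1 : ℝ) / 2 ≤ √(Real.log m) := by
        apply Real.le_sqrt_of_sq_le
        have : Real.log 2 ≤ Real.log m := Real.log_le_log (by norm_num) (by exact_mod_cast hm)
        linarith [Real.log_two_gt_d9]
      have a4 : 128 * M * √s * (1 / 2) ≤ 128 * M * √s * √(Real.log m) := by gcongr
      have a5 : 0 < M * √s := by positivity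
      linarith
    · simp only [if_neg hk]
      refine ⟨(h1 k x hx).1, fun i => ((h1 k x hx).2 i).trans (le_of_eq ?_)⟩
      have : √((4 ^ k : ℕ) : ℝ) = 2 ^ k := by
        rw [Real.sqrt_eq_iff_mul_self_eq (by positivity) (by positivity)]
        push_cast
        rw [← mul_pow]; norm_num
      rw [this]
      ring
  · intro k
    by_cases hk : k = 0
    · subst hk
      simp only [if_true]
      have : (T.image fun _ => (0 : Fin n → ℂ)) ⊆ {0} := by
        intro y hy
        obtain ⟨x, _, rfl⟩ := Finset.mem_image.1 hy
        simp
      refine (Finset.card_le_card this).trans ?_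
      simp
    · simp only [if_neg hk]
      exact h2 k

lemma Q_sub {n m : ℕ} (v : Fin m → Fin n → ℂ) (ε : Fin m → ℝ) (x y : Fin n → ℂ) :
    Q v ε x - Q v ε y = ∑ i, ε i * (‖ip (v i) x‖ ^ 2 - ‖ip (v i) y‖ ^ 2) := by
  unfold Q
  rw [← Finset.sum_sub_distrib]
  exact Finset.sum_congr rfl fun i _ => by ring

lemma main_pos {n m s : ℕ} (M : ℝ) (v : Fin m → Fin n → ℂ) (hn : 2 ≤ n) (hm : 2 ≤ m)
    (hs : 2 ≤ s) (hM : 0 < M) (hv : ∀ i a, ‖v i a‖ ≤ M) :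
    (∫ ε, snormS s (∑ i, (ε i : ℂ) • Matrix.vecMulVec (v i) (star (v i)))
        ∂(rademacherPi m))
      ≤ 240000 * M * √s * Real.log s * √(Real.log m * Real.log n) *
        √(snormS s (∑ i, Matrix.vecMulVec (v i) (star (v i)))) := by
  classical
  obtain ⟨T, h0T, hTcard, hTprop, hTnet⟩ := exists_net n s hs hn
  set r := snormS s (∑ i, Matrix.vecMulVec (v i) (star (v i))) with hr
  have hr0 : 0 ≤ r := snorm_nonneg s _
  have hs' : (2 : ℝ) ≤ s := by exact_mod_cast hs
  have hlogn : 0 < Real.log n := Real.log_pos (by exact_mod_cast hn)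
  have hlogm : 0 < Real.log m := Real.log_pos (by exact_mod_cast hm)
  have hlogs : Real.log 2 ≤ Real.log s := Real.log_le_log (by norm_num) hs'
  have hlog2 := Real.log_two_gt_d9
  have hl1 : ∀ x ∈ T, ∑ a, (|(x a).re| + |(x a).im|) ≤ 4 * √s := by
    intro x hx
    obtain ⟨h4, Γ, hΓ, hxΓ⟩ := hTprop x hx
    exact l1_le x Γ hΓ hxΓ h4
  have hE : ∀ x ∈ T, ∑ i, ‖ip (v i) x‖ ^ 2 ≤ r * 4 := by
    intro x hx
    obtain ⟨h4, Γ, hΓ, hxΓ⟩ := hTprop x hx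
    exact (sum_ip_sq_le s v Γ hΓ x hxΓ).trans (mul_le_mul_of_nonneg_left h4 hr0)
  obtain ⟨π, hπ0, hπ, hπcard⟩ := exists_chain hm hs v M hM hv T h0T hl1
  set c0 := 128 * M * √s * √(Real.log m) with hc0
  have hc0p : 0 ≤ c0 := by positivity
  set Λ := √(Real.log n) with hΛ
  have hΛ0 : 0 ≤ Λ := Real.sqrt_nonneg _
  set K := Nat.log 2 s + 1 with hK
  -- increments between consecutive levels
  have hlev : ∀ k : ℕ, ∃ G : (Fin m → ℝ) → ℝ, Integrable G (rademacherPi m) ∧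
      (∀ x ∈ T, ∀ ε, |Q v ε (π (k + 1) x) - Q v ε (π k x)| ≤ G ε) ∧
      ∫ ε, G ε ∂(rademacherPi m) ≤ 80 * √r * c0 * Λ := by
    intro k
    let co : (Fin n → ℂ) × (Fin n → ℂ) → (Fin m → ℝ) :=
      fun q i => ‖ip (v i) q.2‖ ^ 2 - ‖ip (v i) q.1‖ ^ 2
    let F : Finset (Fin m → ℝ) := (T.image fun x => (π k x, π (k + 1) x)).image co
    have hFcard : F.card ≤ (4 * n + 1) ^ (4 ^ k) * (4 * n + 1) ^ (4 ^ (k + 1)) := by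
      refine Finset.card_image_le.trans ?_
      have : (T.image fun x => (π k x, π (k + 1) x)) ⊆ (T.image (π k)) ×ˢ (T.image (π (k + 1))) := by
        intro y hy
        obtain ⟨x, hx, rfl⟩ := Finset.mem_image.1 hy
        exact Finset.mem_product.2 ⟨Finset.mem_image_of_mem _ hx, Finset.mem_image_of_mem _ hx⟩
      refine (Finset.card_le_card this).trans ?_
      rw [Finset.card_product]
      exact Nat.mul_le_mul (hπcard k) (hπcard (k + 1))
    obtain ⟨G, hG1, hG2, hG3⟩ := max_majorant F (4 * √r * (2 * (c0 / 2 ^ k)))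
      ((21 * 4 ^ k : ℕ) * Real.log n) (by positivity) (by positivity) (by
        intro a ha
        obtain ⟨q, hq, rfl⟩ := Finset.mem_image.1 ha
        obtain ⟨x, hx, rfl⟩ := Finset.mem_image.1 hq
        refine incr _ _ _ r (fun i => ?_) hr0 (hE _ (hπ (k + 1) x hx).1) (hE _ (hπ k x hx).1)
        have b1 := (hπ k x hx).2 i
        have b2 := (hπ (k + 1) x hx).2 i
        have b3 : c0 / 2 ^ (k + 1) ≤ c0 / 2 ^ k := by
          gcongr
          · norm_num
          · omega
        have b4 : ip (v i) (π (k + 1) x) - ip (v i) (π k x)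
          = (ip (v i) x - ip (v i) (π k x)) - (ip (v i) x - ip (v i) (π (k + 1) x)) := by ring
        show ‖ip (v i) (π (k + 1) x) - ip (v i) (π k x)‖ ≤ _
        rw [b4]
        refine (norm_sub_le _ _).trans ?_
        linarith) (by
        rw [← cast_pow_exp n _ hn]
        exact_mod_cast (Nat.mul_le_mul_left 2 hFcard).trans (card_bound_level n k hn))
    refine ⟨G, hG1, ?_, ?_⟩
    · intro x hx ε
      rw [Q_sub]
      exact hG2 _ (Finset.mem_image_of_mem co (Finset.mem_image_of_mem _ hx)) ε
    · refine hG3.trans ?_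
      have e : √((21 * 4 ^ k : ℕ) * Real.log n) ≤ 5 * 2 ^ k * Λ := by
        rw [Real.sqrt_le_left (by positivity), mul_pow, hΛ, Real.sq_sqrt hlogn.le]
        refine mul_le_mul_of_nonneg_right ?_ hlogn.le
        push_cast
        have : ((5 : ℝ) * 2 ^ k) ^ 2 = 25 * 4 ^ k := by
          rw [mul_pow, ← pow_mul, mul_comm k 2, pow_mul]; norm_num
        rw [this]
        gcongr
        norm_num
      calc 2 * (4 * √r * (2 * (c0 / 2 ^ k))) * √((21 * 4 ^ k : ℕ) * Real.log n)
          ≤ 2 * (4 * √r * (2 * (c0 / 2 ^ k))) * (5 * 2 ^ k * Λ) := by gcongr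
        _ = 80 * √r * c0 * Λ := by field_simp; ring
  -- the last increment
  have hlast : ∃ G : (Fin m → ℝ) → ℝ, Integrable G (rademacherPi m) ∧
      (∀ x ∈ T, ∀ ε, |Q v ε x - Q v ε (π K x)| ≤ G ε) ∧
      ∫ ε, G ε ∂(rademacherPi m) ≤ 32 * √r * c0 * Λ := by
    let co : (Fin n → ℂ) → (Fin m → ℝ) :=
      fun x i => ‖ip (v i) x‖ ^ 2 - ‖ip (v i) (π K x)‖ ^ 2
    have hFcard : (T.image co).card ≤ n ^ s * ((80 * s + 1) * (80 * s + 1)) ^ s :=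
      Finset.card_image_le.trans hTcard
    obtain ⟨G, hG1, hG2, hG3⟩ := max_majorant (T.image co) (4 * √r * (c0 / 2 ^ K))
      ((10 * s ^ 2 : ℕ) * Real.log n) (by positivity) (by positivity) (by
        intro a ha
        obtain ⟨x, hx, rfl⟩ := Finset.mem_image.1 ha
        exact incr _ _ _ r (fun i => (hπ K x hx).2 i) hr0 (hE _ hx) (hE _ (hπ K x hx).1)) (by
        rw [← cast_pow_exp n _ hn]
        exact_mod_cast (Nat.mul_le_mul_left 2 hFcard).trans (card_bound_net n s hn hs))
    refine ⟨G, hG1, ?_, ?_⟩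
    · intro x hx ε
      rw [Q_sub]
      exact hG2 _ (Finset.mem_image_of_mem co hx) ε
    · refine hG3.trans ?_
      have e : √((10 * s ^ 2 : ℕ) * Real.log n) ≤ 4 * s * Λ := by
        rw [Real.sqrt_le_left (by positivity), mul_pow, hΛ, Real.sq_sqrt hlogn.le]
        refine mul_le_mul_of_nonneg_right ?_ hlogn.le
        push_cast
        nlinarith
      have e2 : (s : ℝ) ≤ 2 ^ K := by
        exact_mod_cast (Nat.lt_pow_succ_log_self (by norm_num) s).le
      have e3 : c0 / 2 ^ K ≤ c0 / s := by gcongr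
      calc 2 * (4 * √r * (c0 / 2 ^ K)) * √((10 * s ^ 2 : ℕ) * Real.log n)
          ≤ 2 * (4 * √r * (c0 / s)) * (4 * s * Λ) := by gcongr
        _ = 32 * √r * c0 * Λ := by field_simp; ring
  choose G hG1 hG2 hG3 using hlev
  obtain ⟨H, hH1, hH2, hH3⟩ := hlast
  have hpt : ∀ ε, snormS s (∑ i, (ε i : ℂ) • Matrix.vecMulVec (v i) (star (v i)))
      ≤ 6 * (∑ k ∈ Finset.range K, G k ε + H ε) := by
    intro ε
    have hb : ∀ x ∈ T, |Q v ε x| ≤ ∑ k ∈ Finset.range K, G k ε + H ε := by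
      intro x hx
      have hQ0 : Q v ε (π 0 x) = 0 := by rw [hπ0]; simp [Q, ip_zero]
      have e : Q v ε x = ∑ k ∈ Finset.range K, (Q v ε (π (k + 1) x) - Q v ε (π k x))
          + (Q v ε x - Q v ε (π K x)) := by
        rw [Finset.sum_range_sub (fun k => Q v ε (π k x)), hQ0]; ring
      rw [e]
      refine (abs_add_le _ _).trans (add_le_add ?_ (hH2 x hx ε))
      exact (Finset.abs_sum_le_sum_abs _ _).trans
        (Finset.sum_le_sum fun k _ => hG2 k x hx ε)
    exact snorm_le_of_net s v ε T _ ((abs_nonneg _).trans (hb 0 h0T)) hTnet hb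
  have hsumint : Integrable (fun ε => ∑ k ∈ Finset.range K, G k ε) (rademacherPi m) :=
    integrable_finsetSum _ fun k _ => hG1 k
  have hint : Integrable (fun ε => 6 * (∑ k ∈ Finset.range K, G k ε + H ε)) (rademacherPi m) :=
    (hsumint.add hH1).const_mul 6
  refine (integral_mono_of_nonneg (Filter.Eventually.of_forall fun ε => snorm_nonneg s _) hint
    (Filter.Eventually.of_forall hpt)).trans ?_
  rw [integral_const_mul, integral_add hsumint hH1, integral_finsetSum _ fun k _ => hG1 k]
  have hS : ∑ k ∈ Finset.range K, ∫ ε, G k ε ∂(rademacherPi m) ≤ K * (80 * √r * c0 * Λ) := by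
    refine (Finset.sum_le_card_nsmul _ _ _ fun k _ => hG3 k).trans (le_of_eq ?_)
    rw [Finset.card_range, nsmul_eq_mul]
  have hKs : (K : ℝ) ≤ 3 * Real.log s := by
    have h1 : (2 : ℝ) ^ (Nat.log 2 s) ≤ s := by
      exact_mod_cast Nat.pow_log_le_self 2 (by omega)
    have h2 := Real.log_le_log (by positivity) h1
    rw [Real.log_pow] at h2
    rw [hK]
    push_cast
    have h3 : (0 : ℝ) ≤ Nat.log 2 s := Nat.cast_nonneg _
    nlinarith
  set Y := √r * c0 * Λ with hY
  have hY0 : 0 ≤ Y := by positivity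
  have hfinal : 240000 * M * √s * Real.log s * √(Real.log m * Real.log n) * √r
      = 1875 * Real.log s * Y := by
    rw [hY, hc0, hΛ, Real.sqrt_mul hlogm.le]; ring
  rw [hfinal]
  have hS' : ∑ k ∈ Finset.range K, ∫ ε, G k ε ∂(rademacherPi m) ≤ 240 * Real.log s * Y := by
    refine hS.trans ?_
    have : (K : ℝ) * (80 * √r * c0 * Λ) = K * (80 * Y) := by rw [hY]; ring
    rw [this]
    nlinarith
  have hH' : ∫ ε, H ε ∂(rademacherPi m) ≤ 64 * Real.log s * Y := by
    refine hH3.trans ?_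
    have : 32 * √r * c0 * Λ = 32 * Y := by rw [hY]; ring
    rw [this]
    nlinarith
  have : 0 ≤ Real.log s * Y := mul_nonneg (by linarith) hY0
  linarith

end RV

theorem stmt7 : ∃ C : ℝ, 0 < C ∧
    ∀ (n m s : ℕ) (M : ℝ) (v : Fin m → Fin n → ℂ), 2 ≤ n → 2 ≤ m → 2 ≤ s →
    (∀ i, ∀ a, ‖v i a‖ ≤ M) →
    (∫ ε, snormS s (∑ i, (ε i : ℂ) • Matrix.vecMulVec (v i) (star (v i)))
        ∂(rademacherPi m))
      ≤ C * M * Real.sqrt s * Real.log s * Real.sqrt (Real.log m * Real.log n) *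
        Real.sqrt (snormS s (∑ i, Matrix.vecMulVec (v i) (star (v i)))) := by

  refine ⟨240000, by norm_num, ?_⟩
  intro n m s M v hn hm hs hv
  have hM : 0 ≤ M := (norm_nonneg _).trans (hv ⟨0, by omega⟩ ⟨0, by omega⟩)
  rcases hM.eq_or_lt with h | h
  · have hv0 : ∀ i, v i = 0 := by
      intro i
      funext a
      have := hv i a
      rw [← h] at this
      simpa using this
    have hz : snormS s (0 : Matrix (Fin n) (Fin n) ℂ) = 0 := by
      refine le_antisymm (RV.snorm_le s _ 0 le_rfl ?_) (RV.snorm_nonneg s _)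
      intros
      simp
    simp [hv0, hz]
  · exact RV.main_pos M v hn hm hs h hv
end

section
/- There exists an absolute constant C > 0 such that the following holds. Let n, m ≥ 2, let s ≥ 2, let u₁, …, u_m ∈ ℂ^n and v₁, …, v_m ∈ ℂ^n satisfy ‖u_i‖_∞ ≤ M and ‖v_i‖_∞ ≤ M for all i, let U and V be the n × m matrices with columns u_i and v_i respectively, and let ε₁, …, ε_m be i.i.d. Rademacher random variables (taking values ±1 with probability 1/2). Then E ‖ Σ_{i=1}^m ε_i u_i v_i* ‖_s ≤ C · M · s^{1/2} · log s · √(log m · log n) · ( ‖V V*‖_s^{1/2} + ‖U U*‖_s^{1/2} ). -/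
open MeasureTheory ProbabilityTheory Matrix

/-- signs -/
def sg {m : ℕ} (σ : Fin m → Bool) (i : Fin m) : ℝ := if σ i then 1 else -1

lemma one_step {κ : Type*} [Fintype κ] (p h : κ → ℝ) (hp : ∀ k, 0 ≤ p k) (hp1 : ∑ k, p k = 1)
    (K l : ℝ) (hh : ∀ k, |h k| ≤ K) :
    ∑ k, p k * Real.exp (l * (h k - ∑ j, p j * h j)) ≤ Real.exp (2 * l ^ 2 * K ^ 2) := by
  have jen : Real.exp (- l * ∑ j, p j * h j) ≤ ∑ j, p j * Real.exp (- l * h j) := by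
    have := convexOn_exp.map_sum_le (t := Finset.univ) (w := p) (p := fun j => - l * h j)
      (fun i _ => hp i) hp1 (fun i _ => Set.mem_univ _)
    simp only [smul_eq_mul] at this
    have e0 : - l * ∑ j, p j * h j = ∑ j, p j * (- l * h j) := by
      rw [Finset.mul_sum]; exact Finset.sum_congr rfl fun _ _ => by ring
    rw [e0]; exact this
  have e1 : ∑ k, p k * Real.exp (l * (h k - ∑ j, p j * h j))
      ≤ ∑ k, ∑ j, p k * p j * Real.exp (l * (h k - h j)) := by
    apply Finset.sum_le_sum
    intro k _
    have : Real.exp (l * (h k - ∑ j, p j * h j))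
        = Real.exp (l * h k) * Real.exp (- l * ∑ j, p j * h j) := by
      rw [← Real.exp_add]; congr 1; ring
    rw [this]
    calc _ ≤ p k * (Real.exp (l * h k) * ∑ j, p j * Real.exp (- l * h j)) := by
          gcongr; exact hp k
      _ = _ := by
          rw [Finset.mul_sum, Finset.mul_sum]
          refine Finset.sum_congr rfl fun j _ => ?_
          have : Real.exp (l * (h k - h j)) = Real.exp (l * h k) * Real.exp (- l * h j) := by
            rw [← Real.exp_add]; congr 1; ring
          rw [this]; ring
  have e2 : ∑ k, ∑ j, p k * p j * Real.exp (l * (h k - h j))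
      = ∑ k, ∑ j, p k * p j * Real.cosh (l * (h k - h j)) := by
    have sw : ∑ k, ∑ j, p k * p j * Real.exp (l * (h k - h j))
      = ∑ k, ∑ j, p k * p j * Real.exp (-(l * (h k - h j))) := by
      rw [Finset.sum_comm]
      refine Finset.sum_congr rfl fun j _ => Finset.sum_congr rfl fun k _ => ?_
      rw [mul_comm (p k)]; congr 2; ring
    have : ∑ k, ∑ j, p k * p j * Real.cosh (l * (h k - h j))
      = (∑ k, ∑ j, p k * p j * Real.exp (l * (h k - h j)) +
        ∑ k, ∑ j, p k * p j * Real.exp (-(l * (h k - h j)))) / 2 := by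
      rw [← Finset.sum_add_distrib, Finset.sum_div]
      refine Finset.sum_congr rfl fun j _ => ?_
      rw [← Finset.sum_add_distrib, Finset.sum_div]
      refine Finset.sum_congr rfl fun k _ => ?_
      rw [Real.cosh_eq]; ring
    rw [this, ← sw]; ring
  have e3 : ∑ k, ∑ j, p k * p j * Real.cosh (l * (h k - h j))
      ≤ ∑ k, ∑ j, p k * p j * Real.exp (2 * l ^ 2 * K ^ 2) := by
    refine Finset.sum_le_sum fun k _ => Finset.sum_le_sum fun j _ => ?_
    have hpp := mul_nonneg (hp k) (hp j)
    gcongr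
    refine (Real.cosh_le_exp_half_sq _).trans (Real.exp_le_exp.2 ?_)
    have h1 := abs_le.1 (hh k)
    have h2 := abs_le.1 (hh j)
    have h3 : (h k - h j) ^ 2 ≤ (2 * K) ^ 2 := by
      apply sq_le_sq'  <;> linarith
    nlinarith [mul_le_mul_of_nonneg_left h3 (sq_nonneg l)]
  have e4 : ∑ k, ∑ j, p k * p j * Real.exp (2 * l ^ 2 * K ^ 2) = Real.exp (2 * l ^ 2 * K ^ 2) := by
    simp_rw [← Finset.sum_mul, ← Finset.mul_sum, hp1]
    simp [hp1]
  linarith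

lemma maurey_pot {κ J : Type*} [Fintype κ] [Fintype J] (p : κ → ℝ) (H : J → κ → ℝ)
    (hp : ∀ k, 0 ≤ p k) (hp1 : ∑ k, p k = 1)
    (K l : ℝ) (hh : ∀ j k, |H j k| ≤ K) (r : ℕ) :
    ∃ f : Fin r → κ, ∑ j, Real.exp (l * ∑ t, (H j (f t) - ∑ k, p k * H j k))
      ≤ Fintype.card J * Real.exp (2 * l ^ 2 * K ^ 2 * r) := by
  induction r with
  | zero => exact ⟨Fin.elim0, by simp⟩
  | succ r ih =>
    obtain ⟨f, hf⟩ := ih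
    set W : J → ℝ := fun j => Real.exp (l * ∑ t, (H j (f t) - ∑ k, p k * H j k)) with hW
    have avg : ∑ k, p k * (∑ j, W j * Real.exp (l * (H j k - ∑ k, p k * H j k)))
        ≤ ∑ k, p k * (Real.exp (2 * l ^ 2 * K ^ 2) * ∑ j, W j) := by
      rw [← Finset.sum_mul, hp1, one_mul, Finset.mul_sum]
      simp_rw [Finset.mul_sum]
      rw [Finset.sum_comm]
      refine Finset.sum_le_sum fun j _ => ?_
      have := one_step p (H j) hp hp1 K l (hh j)
      calc _ = W j * ∑ k, p k * Real.exp (l * (H j k - ∑ i, p i * H j i)) := by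
            rw [Finset.mul_sum]; exact Finset.sum_congr rfl fun _ _ => by ring
        _ ≤ W j * Real.exp (2 * l ^ 2 * K ^ 2) := by
            apply mul_le_mul_of_nonneg_left this (Real.exp_nonneg _)
        _ = _ := mul_comm _ _
    have : ∃ k, (∑ j, W j * Real.exp (l * (H j k - ∑ k, p k * H j k)))
        ≤ Real.exp (2 * l ^ 2 * K ^ 2) * ∑ j, W j := by
      by_contra hcon
      push Not at hcon
      have hex : ∃ k, 0 < p k := by
        by_contra hc
        push Not at hc
        have : ∑ k, p k ≤ 0 := Finset.sum_nonpos fun k _ => hc k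
        linarith
      obtain ⟨k0, hk0⟩ := hex
      refine absurd avg (not_le.2 (Finset.sum_lt_sum (fun k _ => ?_) ⟨k0, Finset.mem_univ _, ?_⟩))
      · exact mul_le_mul_of_nonneg_left (hcon k).le (hp k)
      · exact mul_lt_mul_of_pos_left (hcon k0) hk0
    obtain ⟨k, hk⟩ := this
    refine ⟨Fin.snoc f k, ?_⟩
    have : ∀ j, Real.exp (l * ∑ t, (H j ((Fin.snoc f k : Fin (r+1) → κ) t) - ∑ k, p k * H j k))
        = W j * Real.exp (l * (H j k - ∑ k, p k * H j k)) := by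
      intro j
      rw [Fin.sum_univ_castSucc]
      simp only [Fin.snoc_castSucc, Fin.snoc_last]
      rw [mul_add, Real.exp_add]
    simp_rw [this]
    refine hk.trans ?_
    calc _ ≤ Real.exp (2 * l ^ 2 * K ^ 2) * (Fintype.card J * Real.exp (2 * l ^ 2 * K ^ 2 * r)) := by
          gcongr
      _ = _ := by
          rw [mul_left_comm, ← Real.exp_add]; congr 2; push_cast; ring

lemma maurey_real {κ J : Type*} [Fintype κ] [Fintype J] (p : κ → ℝ) (H : J → κ → ℝ)
    (hp : ∀ k, 0 ≤ p k) (hp1 : ∑ k, p k = 1)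
    (K : ℝ) (hK : 0 ≤ K) (hh : ∀ j k, |H j k| ≤ K) (r : ℕ) (hr : 0 < r) (Q : ℝ) (hQ : 1 < Q)
    (hJ : (Fintype.card J : ℝ) ≤ Q) :
    ∃ f : Fin r → κ, ∀ j, (1 / (r:ℝ)) * ∑ t, H j (f t) - ∑ k, p k * H j k
      ≤ 3 * K * Real.sqrt (Real.log Q) / Real.sqrt r := by
  rcases hK.eq_or_lt with h0 | hKp
  · have hz : ∀ j k, H j k = 0 := fun j k => by
      have := hh j k; rw [← h0] at this; simpa using this
    have : Nonempty κ := by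
      by_contra hc
      rw [not_nonempty_iff] at hc
      simp at hp1
    exact ⟨fun _ => Classical.arbitrary κ, fun j => by simp [hz, ← h0]⟩
  have hr' : (0:ℝ) < r := by exact_mod_cast hr
  have hlog : 0 < Real.log Q := Real.log_pos hQ
  set a := Real.sqrt (Real.log Q) with ha
  have hap : 0 < a := Real.sqrt_pos.2 hlog
  have haa : a ^ 2 = Real.log Q := Real.sq_sqrt hlog.le
  set b := Real.sqrt r with hb
  have hbp : 0 < b := Real.sqrt_pos.2 hr'
  have hbb : b ^ 2 = r := Real.sq_sqrt hr'.le
  set l := a / (K * b) with hl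
  have hlp : 0 < l := by positivity
  obtain ⟨f, hf⟩ := maurey_pot p H hp hp1 K l hh r
  refine ⟨f, fun j => ?_⟩
  have h1 : Real.exp (l * ∑ t, (H j (f t) - ∑ k, p k * H j k)) ≤
      Real.exp (Real.log Q + 2 * l ^ 2 * K ^ 2 * r) := by
    rw [Real.exp_add, Real.exp_log (by linarith)]
    refine le_trans ?_ (hf.trans ?_)
    · exact Finset.single_le_sum (f := fun j => Real.exp (l * ∑ t, (H j (f t) - ∑ k, p k * H j k)))
        (fun i _ => (Real.exp_nonneg _)) (Finset.mem_univ j)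
    · gcongr
  rw [Real.exp_le_exp] at h1
  have h2 : 2 * l ^ 2 * K ^ 2 * r = 2 * a ^ 2 := by
    rw [hl, ← hbb]; field_simp
  rw [h2, ← haa] at h1
  have h3 : ∑ t, (H j (f t) - ∑ k, p k * H j k) = ∑ t, H j (f t) - r * ∑ k, p k * H j k := by
    rw [Finset.sum_sub_distrib]; simp
  rw [h3] at h1
  have h4 : ∑ t, H j (f t) - r * ∑ k, p k * H j k ≤ 3 * a * K * b := by
    have : l * (∑ t, H j (f t) - r * ∑ k, p k * H j k) ≤ l * (3 * a * K * b) := by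
      refine h1.trans (le_of_eq ?_)
      rw [hl]; field_simp; ring
    exact le_of_mul_le_mul_left this hlp
  rw [← hbb] at h4 ⊢
  rw [le_div_iff₀ hbp]
  have h5 : (1 / b ^ 2 * ∑ t, H j (f t) - ∑ k, p k * H j k) * b =
    (∑ t, H j (f t) - b ^ 2 * ∑ k, p k * H j k) / b := by field_simp
  rw [h5, div_le_iff₀ hbp]; linarith

lemma mgf {m : ℕ} (c : Fin m → ℝ) (l : ℝ) :
    (∑ σ : Fin m → Bool, Real.exp (l * ∑ i, sg σ i * c i)) / 2 ^ m
      ≤ Real.exp (l ^ 2 * (∑ i, c i ^ 2) / 2) := by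
  have h1 : ∑ σ : Fin m → Bool, Real.exp (l * ∑ i, sg σ i * c i)
      = ∏ i, ∑ b : Bool, Real.exp (l * ((if b then 1 else -1) * c i)) := by
    rw [Finset.prod_univ_sum]
    rw [Fintype.piFinset_univ]
    refine Finset.sum_congr rfl fun σ _ => ?_
    rw [← Real.exp_sum, Finset.mul_sum]; rfl
  rw [h1]
  have h2 : (2:ℝ) ^ m = ∏ i : Fin m, 2 := by simp
  rw [h2, ← Finset.prod_div_distrib, Finset.mul_sum, Finset.sum_div, Real.exp_sum]
  refine Finset.prod_le_prod (fun i _ => by positivity) fun i _ => ?_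
  have := Real.cosh_le_exp_half_sq (l * c i)
  rw [Real.cosh_eq, mul_pow] at this
  simpa using this

lemma emax_real {m : ℕ} {T : Type*} [Fintype T] (c : T → Fin m → ℝ) (s N : ℝ) (hs : 0 ≤ s)
    (hN : 1 < N) (hT : (Fintype.card T : ℝ) ≤ N) (hc : ∀ t, ∑ i, c t i ^ 2 ≤ s ^ 2) :
    ∃ g : (Fin m → Bool) → ℝ, (∀ σ t, ∑ i, sg σ i * c t i ≤ g σ) ∧
      (∑ σ, g σ) / 2 ^ m ≤ 2 * s * Real.sqrt (Real.log N) := by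
  rcases hs.eq_or_lt with h0 | hsp
  · refine ⟨fun _ => 0, fun σ t => ?_, by simp [← h0]⟩
    have h1 := hc t
    rw [← h0] at h1
    have h2 : ∑ i, c t i ^ 2 = 0 := le_antisymm (by simpa using h1)
      (Finset.sum_nonneg fun i _ => sq_nonneg _)
    rw [Finset.sum_eq_zero_iff_of_nonneg (fun i _ => sq_nonneg _)] at h2
    refine (Finset.sum_eq_zero fun i hi => ?_).le
    have := h2 i hi
    simp at this; simp [this]
  have hlog : 0 < Real.log N := Real.log_pos hN
  set a := Real.sqrt (Real.log N) with ha
  have hap : 0 < a := Real.sqrt_pos.2 hlog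
  have haa : a ^ 2 = Real.log N := Real.sq_sqrt hlog.le
  set l := a / s with hl
  have hlp : 0 < l := by positivity
  have hls : l ^ 2 * s ^ 2 = a ^ 2 := by rw [hl]; field_simp
  set B := a ^ 2 + a ^ 2 / 2 with hB
  refine ⟨fun σ => (1 / l) * (B - 1 + ∑ t, Real.exp (l * ∑ i, sg σ i * c t i) * Real.exp (-B)),
    fun σ t => ?_, ?_⟩
  · have h1 := Real.add_one_le_exp (l * ∑ i, sg σ i * c t i + -B)
    rw [Real.exp_add] at h1
    have h2 := Finset.single_le_sum (f := fun t => Real.exp (l * ∑ i, sg σ i * c t i) * Real.exp (-B))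
        (fun i _ => by positivity) (Finset.mem_univ t)
    beta_reduce
    rw [one_div, inv_mul_eq_div, le_div_iff₀ hlp]
    linarith
  · rw [← Finset.mul_sum, Finset.sum_add_distrib, Finset.sum_comm]
    simp_rw [← Finset.sum_mul]
    have h1 : (∑ t, ∑ σ : Fin m → Bool, Real.exp (l * ∑ i, sg σ i * c t i)) / 2 ^ m ≤ Real.exp B := by
      rw [Finset.sum_div]
      calc _ ≤ ∑ t : T, Real.exp (a ^ 2 / 2) := by
            refine Finset.sum_le_sum fun t _ => (mgf (c t) l).trans (Real.exp_le_exp.2 ?_)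
            have := mul_le_mul_of_nonneg_left (hc t) (sq_nonneg l)
            linarith
        _ = Fintype.card T * Real.exp (a ^ 2 / 2) := by simp
        _ ≤ N * Real.exp (a ^ 2 / 2) := by gcongr
        _ = _ := by rw [hB, Real.exp_add, haa, Real.exp_log (by linarith)]
    have h2 : (∑ t, ∑ σ : Fin m → Bool, Real.exp (l * ∑ i, sg σ i * c t i)) / 2 ^ m * Real.exp (-B) ≤ 1 := by
      calc _ ≤ Real.exp B * Real.exp (-B) := by gcongr
        _ = 1 := by rw [← Real.exp_add]; simp
    have h3 : (1 / l * (∑ _i : Fin m → Bool, (B - 1) +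
      (∑ t, ∑ σ : Fin m → Bool, Real.exp (l * ∑ i, sg σ i * c t i)) * Real.exp (-B))) / 2 ^ m
      = 1 / l * (B - 1 + (∑ t, ∑ σ : Fin m → Bool, Real.exp (l * ∑ i, sg σ i * c t i)) / 2 ^ m * Real.exp (-B)) := by
      simp; field_simp
    rw [h3]
    calc _ ≤ 1 / l * B := by gcongr; linarith
      _ = 3 / 2 * s * a := by rw [hl, hB]; field_simp; ring
      _ ≤ _ := by nlinarith [mul_pos hsp hap]

lemma emax {m : ℕ} (F : Finset (Fin m → ℂ)) (s N : ℝ) (hs : 0 ≤ s)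
    (hN : 1 ≤ N) (hT : (F.card : ℝ) ≤ N) (hc : ∀ c ∈ F, ∑ i, ‖c i‖ ^ 2 ≤ s ^ 2) :
    ∃ g : (Fin m → Bool) → ℝ, (∀ σ, ∀ c ∈ F, ‖∑ i, (sg σ i : ℂ) * c i‖ ≤ g σ) ∧
      (∑ σ, g σ) / 2 ^ m ≤ 4 * s * Real.sqrt (Real.log (4 * N)) := by
  obtain ⟨g, hg, hg2⟩ := emax_real (m := m) (T := F × Bool × Bool)
    (fun t i => (if t.2.1 then 1 else -1) * (if t.2.2 then (t.1.1 i).re else (t.1.1 i).im)) s (4 * N) hs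
    (by linarith) (by
      simp only [Fintype.card_prod, Fintype.card_coe, Fintype.card_bool]; push_cast; linarith)
    (by
      rintro ⟨⟨c, hcF⟩, b1, b2⟩
      refine le_trans (Finset.sum_le_sum fun i _ => ?_) (hc c hcF)
      have : ‖c i‖ ^ 2 = (c i).re ^ 2 + (c i).im ^ 2 := by
        rw [← Complex.normSq_eq_norm_sq, Complex.normSq_apply]; ring
      rw [this]
      cases b1 <;> cases b2 <;> simp <;> nlinarith [sq_nonneg (c i).re, sq_nonneg (c i).im])
  refine ⟨fun σ => 2 * g σ, fun σ c hcF => ?_, ?_⟩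
  · have h := fun b1 b2 => hg σ (⟨c, hcF⟩, b1, b2)
    have hre : (∑ i, (sg σ i : ℂ) * c i).re = ∑ i, sg σ i * (c i).re := by simp
    have him : (∑ i, (sg σ i : ℂ) * c i).im = ∑ i, sg σ i * (c i).im := by simp
    have h1 := h true true
    have h2 := h true false
    have h3 := h false true
    have h4 := h false false
    simp at h1 h2 h3 h4
    have := Complex.norm_le_abs_re_add_abs_im (∑ i, (sg σ i : ℂ) * c i)
    rw [hre, him] at this
    have a1 : |∑ i, sg σ i * (c i).re| ≤ g σ := abs_le.2 ⟨by linarith, h1⟩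
    have a2 : |∑ i, sg σ i * (c i).im| ≤ g σ := abs_le.2 ⟨by linarith, h2⟩
    linarith
  · rw [← Finset.mul_sum, mul_div_assoc]; linarith

lemma reps {α β : Type*} (D : Set α) (F : Finset β) (R : α → β → Prop)
    (h : ∀ x ∈ D, ∃ b ∈ F, R x b) :
    ∃ N : Finset α, (∀ z ∈ N, z ∈ D) ∧ N.card ≤ F.card ∧ ∀ x ∈ D, ∃ z ∈ N, ∃ b ∈ F, R x b ∧ R z b := by
  classical
  rcases D.eq_empty_or_nonempty with rfl | ⟨x0, hx0⟩
  · exact ⟨∅, by simp⟩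
  have : ∀ b : β, ∃ z : α, (∃ x ∈ D, R x b) → z ∈ D ∧ R z b := by
    intro b
    by_cases hb : ∃ x ∈ D, R x b
    · obtain ⟨x, hx⟩ := hb; exact ⟨x, fun _ => hx⟩
    · exact ⟨x0, fun h => absurd h hb⟩
  choose φ hφ using this
  refine ⟨(F.filter (fun b => ∃ x ∈ D, R x b)).image φ, ?_, ?_, ?_⟩
  · intro z hz
    simp only [Finset.mem_image, Finset.mem_filter] at hz
    obtain ⟨b, ⟨_, hb⟩, rfl⟩ := hz
    exact (hφ b hb).1
  · exact Finset.card_image_le.trans (Finset.card_filter_le _ _)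
  · intro x hx
    obtain ⟨b, hb, hR⟩ := h x hx
    have hex : ∃ x ∈ D, R x b := ⟨x, hx, hR⟩
    exact ⟨φ b, Finset.mem_image_of_mem _ (Finset.mem_filter.2 ⟨hb, hex⟩), b, hb, hR, (hφ b hex).2⟩

lemma integral_rad (m : ℕ) (f : (Fin m → ℝ) → ℝ) :
    ∫ ε, f ε ∂(rademacherPi m) = (∑ σ : Fin m → Bool, f (sg σ)) / 2 ^ m := by
  let μB : Measure Bool := (1 / 2 : ENNReal) • Measure.dirac true + (1 / 2 : ENNReal) • Measure.dirac false
  have hm : Measurable (fun b : Bool => if b then (1:ℝ) else -1) := measurable_of_countable _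
  have hprob : IsProbabilityMeasure μB := ⟨by
    simp only [μB, Measure.add_apply, Measure.smul_apply, measure_univ, smul_eq_mul, mul_one]
    simp [ENNReal.inv_two_add_inv_two]⟩
  have h1 : rademacher = μB.map (fun b : Bool => if b then (1:ℝ) else -1) := by
    simp only [μB, rademacher]
    rw [Measure.map_add _ _ hm, Measure.map_smul, Measure.map_smul, Measure.map_dirac' hm,
      Measure.map_dirac' hm]
    simp
  have hpr : IsProbabilityMeasure (μB.map (fun b : Bool => if b then (1:ℝ) else -1)) :=
    Measure.isProbabilityMeasure_map hm.aemeasurable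
  have h2 : rademacherPi m = (Measure.pi fun _ : Fin m => μB).map sg := by
    rw [rademacherPi]
    simp_rw [h1]
    rw [← Measure.pi_map_pi (μ := fun _ : Fin m => μB) (fun _ => hm.aemeasurable)]
    rfl
  have hemb : MeasurableEmbedding (sg : (Fin m → Bool) → Fin m → ℝ) := by
    refine ⟨fun a b hab => ?_, measurable_of_countable _, fun s _ => (Set.toFinite _).measurableSet⟩
    funext i
    have := congrFun hab i
    simp only [sg] at this
    cases ha : a i <;> cases hb : b i <;> simp [ha, hb] at this ⊢ <;> norm_num at this
  rw [h2, hemb.integral_map, integral_fintype (Integrable.of_finite), Finset.sum_div]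
  refine Finset.sum_congr rfl fun σ _ => ?_
  have h3 : (Measure.pi fun _ : Fin m => μB).real {σ} = 1 / 2 ^ m := by
    rw [measureReal_def, Measure.pi_singleton, ENNReal.toReal_prod]
    have : ∀ b : Bool, (μB {b}).toReal = 1 / 2 := by
      intro b
      cases b <;> simp [μB]
    simp [this]
  rw [h3, smul_eq_mul]; ring

/-- the functional `x ↦ ⟨w i, x⟩` -/
noncomputable def qf {m n : ℕ} (w : Fin m → Fin n → ℂ) (i : Fin m) (x : Fin n → ℂ) : ℂ :=
  ∑ a, star (w i a) * x a

/-- sparse unit ball -/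
def DD (n s : ℕ) : Set (Fin n → ℂ) :=
  {x | (∃ Γ : Finset (Fin n), Γ.card = s ∧ ∀ a, a ∉ Γ → x a = 0) ∧ ∑ a, ‖x a‖ ^ 2 ≤ 1}

lemma qf_sub {m n : ℕ} (w : Fin m → Fin n → ℂ) (i : Fin m) (x y : Fin n → ℂ) :
    qf w i (x - y) = qf w i x - qf w i y := by
  simp [qf, mul_sub]

lemma qf_zero {m n : ℕ} (w : Fin m → Fin n → ℂ) (i : Fin m) : qf w i 0 = 0 := by
  simp [qf]

lemma qf_smul {m n : ℕ} (w : Fin m → Fin n → ℂ) (i : Fin m) (c : ℂ) (x : Fin n → ℂ) :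
    qf w i (c • x) = c * qf w i x := by
  simp only [qf, Finset.mul_sum, Pi.smul_apply, smul_eq_mul]
  exact Finset.sum_congr rfl fun _ _ => by ring

lemma DD_l1 {n s : ℕ} {x : Fin n → ℂ} (hx : x ∈ DD n s) : ∑ a, ‖x a‖ ≤ Real.sqrt s := by
  obtain ⟨⟨Γ, hΓ, h0⟩, h1⟩ := hx
  have e : ∑ a, ‖x a‖ = ∑ a ∈ Γ, ‖x a‖ := by
    symm
    refine Finset.sum_subset (Finset.subset_univ _) fun a _ ha => by simp [h0 a ha]
  rw [e]
  apply Real.le_sqrt_of_sq_le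
  refine (sq_sum_le_card_mul_sum_sq (s := Γ) (f := fun a => ‖x a‖)).trans ?_
  rw [hΓ]
  have : ∑ a ∈ Γ, ‖x a‖ ^ 2 ≤ 1 := le_trans
    (Finset.sum_le_sum_of_subset_of_nonneg (Finset.subset_univ _) fun _ _ _ => sq_nonneg _) h1
  nlinarith [(Nat.cast_nonneg s : (0:ℝ) ≤ s)]

lemma qf_le {m n : ℕ} {w : Fin m → Fin n → ℂ} {M : ℝ} (hw : ∀ i a, ‖w i a‖ ≤ M) (i : Fin m)
    (x : Fin n → ℂ) : ‖qf w i x‖ ≤ M * ∑ a, ‖x a‖ := by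
  rw [qf, Finset.mul_sum]
  refine (norm_sum_le _ _).trans (Finset.sum_le_sum fun a _ => ?_)
  rw [norm_mul, norm_star]
  exact mul_le_mul_of_nonneg_right (hw i a) (norm_nonneg _)

/-- phases -/
noncomputable def ph (b1 b2 : Bool) : ℂ := (if b1 then 1 else -1) * (if b2 then 1 else Complex.I)

lemma maurey_c {m n : ℕ} (w : Fin m → Fin n → ℂ) (M : ℝ) (hM : 0 ≤ M) (hw : ∀ i a, ‖w i a‖ ≤ M)
    (hm : 1 ≤ m) (L : ℝ) (hL : 0 < L) (r : ℕ) (hr : 0 < r) (G : Fin m → Option (Fin n × Bool × Bool) → ℂ)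
    (hG0 : ∀ i, G i none = 0)
    (hG : ∀ i a b1 b2, G i (some (a, b1, b2)) = star (w i a) * ((2 * L : ℝ) * ph b1 b2))
    (x : Fin n → ℂ) (hx : ∑ a, ‖x a‖ ≤ L) :
    ∃ f : Fin r → Option (Fin n × Bool × Bool), ∀ i,
      ‖(1 / (r : ℝ) : ℝ) * ∑ t, G i (f t) - qf w i x‖ ≤
        12 * M * L * Real.sqrt (Real.log (4 * m)) / Real.sqrt r := by
  have hph : ∀ b1 b2, ‖ph b1 b2‖ = 1 := by
    intro b1 b2; cases b1 <;> cases b2 <;> simp [ph]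
  have hGn : ∀ i k, ‖G i k‖ ≤ M * (2 * L) := by
    rintro i (_ | ⟨a, b1, b2⟩)
    · rw [hG0]; simp; positivity
    · rw [hG, norm_mul, norm_mul, norm_star, hph, mul_one, Complex.norm_real, Real.norm_eq_abs,
        abs_of_pos (by positivity)]
      exact mul_le_mul_of_nonneg_right (hw i a) (by positivity)
  let P : Fin n × Bool × Bool → ℝ := fun k =>
    (|if k.2.2 then (x k.1).re else (x k.1).im| + (if k.2.1 then 1 else -1) *
      (if k.2.2 then (x k.1).re else (x k.1).im)) / (4 * L)
  have hP0 : ∀ k, 0 ≤ P k := by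
    rintro ⟨a, b1, b2⟩
    apply div_nonneg _ (by positivity)
    cases b1 <;> simp only [if_true, if_false, Bool.false_eq_true]
    · have := le_abs_self (if b2 then (x a).re else (x a).im)
      linarith
    · have := neg_abs_le (if b2 then (x a).re else (x a).im)
      linarith
  have hPs : ∑ k, P k ≤ 1 := by
    have : ∑ k, P k = (∑ a, (|(x a).re| + |(x a).im|)) / (2 * L) := by
      rw [Fintype.sum_prod_type, Finset.sum_div]
      refine Finset.sum_congr rfl fun a _ => ?_
      rw [Fintype.sum_prod_type]
      simp [P, Fintype.sum_bool]
      field_simp; ring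
    rw [this, div_le_one (by positivity)]
    calc _ ≤ ∑ a, 2 * ‖x a‖ := Finset.sum_le_sum fun a _ => by
          have := Complex.abs_re_le_norm (x a)
          have := Complex.abs_im_le_norm (x a)
          linarith
      _ ≤ _ := by rw [← Finset.mul_sum]; linarith
  let p : Option (Fin n × Bool × Bool) → ℝ := fun k => k.elim (1 - ∑ k, P k) P
  have hp : ∀ k, 0 ≤ p k := by
    rintro (_ | k)
    · simp only [p, Option.elim]; linarith
    · exact hP0 k
  have hp1 : ∑ k, p k = 1 := by
    rw [Fintype.sum_option]; simp [p]
  have hmean : ∀ i, ∑ k, (p k : ℂ) * G i k = qf w i x := by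
    intro i
    rw [Fintype.sum_option, hG0, mul_zero, zero_add, Fintype.sum_prod_type, qf]
    refine Finset.sum_congr rfl fun a _ => ?_
    rw [Fintype.sum_prod_type]
    simp only [Fintype.sum_bool, hG]
    simp only [p, P, Option.elim, ph, if_true, if_false, Bool.false_eq_true]
    have hLc : (L : ℂ) ≠ 0 := by exact_mod_cast hL.ne'
    conv_rhs => rw [← Complex.re_add_im (x a)]
    push_cast
    field_simp
    ring
  obtain ⟨f, hf⟩ := maurey_real (J := Fin m × Bool × Bool) p
    (fun j k => (if j.2.1 then 1 else -1) * (if j.2.2 then (G j.1 k).re else (G j.1 k).im)) hp hp1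
    (M * (2 * L)) (by positivity) (by
      rintro ⟨i, b1, b2⟩ k
      have h1 := (Complex.abs_re_le_norm (G i k)).trans (hGn i k)
      have h2 := (Complex.abs_im_le_norm (G i k)).trans (hGn i k)
      cases b1 <;> cases b2 <;> simpa using by assumption) r hr (4 * m)
    (by have : (1:ℝ) ≤ m := by exact_mod_cast hm
        linarith)
    (by simp only [Fintype.card_prod, Fintype.card_fin, Fintype.card_bool]; push_cast; linarith)
  refine ⟨f, fun i => ?_⟩
  have hre : ((1 / (r : ℝ) : ℝ) * ∑ t, G i (f t) - qf w i x).re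
      = 1 / (r:ℝ) * ∑ t, (G i (f t)).re - ∑ k, p k * (G i k).re := by
    rw [← hmean]
    simp only [Complex.sub_re, Complex.re_ofReal_mul, Complex.re_sum]
  have him : ((1 / (r : ℝ) : ℝ) * ∑ t, G i (f t) - qf w i x).im
      = 1 / (r:ℝ) * ∑ t, (G i (f t)).im - ∑ k, p k * (G i k).im := by
    rw [← hmean]
    simp only [Complex.sub_im, Complex.im_ofReal_mul, Complex.im_sum]
  have h1 := hf (i, true, true)
  have h2 := hf (i, true, false)
  have h3 := hf (i, false, true)
  have h4 := hf (i, false, false)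
  simp only [if_true, if_false, Bool.false_eq_true, one_mul, neg_mul, mul_neg, Finset.sum_neg_distrib] at h1 h2 h3 h4
  have := Complex.norm_le_abs_re_add_abs_im ((1 / (r : ℝ) : ℝ) * ∑ t, G i (f t) - qf w i x)
  rw [hre, him] at this
  have a1 := abs_le.2 ⟨by linarith, h1⟩
  have a2 := abs_le.2 ⟨by linarith, h2⟩
  refine this.trans ((add_le_add a1 a2).trans (le_of_eq ?_))
  ring

lemma maurey_net {m n s : ℕ} (w : Fin m → Fin n → ℂ) (M : ℝ) (hM : 0 ≤ M) (hw : ∀ i a, ‖w i a‖ ≤ M)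
    (hm : 1 ≤ m) (hs : 1 ≤ s) (r : ℕ) (hr : 0 < r) :
    ∃ P : Finset (Fin n → ℂ), (∀ z ∈ P, z ∈ DD n s) ∧ P.card ≤ (4 * n + 1) ^ r ∧
      ∀ x ∈ DD n s, ∃ z ∈ P, ∀ i, ‖qf w i (x - z)‖ ≤
        24 * M * Real.sqrt s * Real.sqrt (Real.log (4 * m)) / Real.sqrt r := by
  have hL : 0 < Real.sqrt s := Real.sqrt_pos.2 (by exact_mod_cast hs)
  let G : Fin m → Option (Fin n × Bool × Bool) → ℂ := fun i k =>
    k.elim 0 fun k => star (w i k.1) * ((2 * Real.sqrt s : ℝ) * ph k.2.1 k.2.2)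
  obtain ⟨P, hP, hc, hPx⟩ := reps (DD n s) (Finset.univ : Finset (Fin r → Option (Fin n × Bool × Bool)))
    (fun x f => ∀ i, ‖(1 / (r : ℝ) : ℝ) * ∑ t, G i (f t) - qf w i x‖ ≤
        12 * M * Real.sqrt s * Real.sqrt (Real.log (4 * m)) / Real.sqrt r) (by
      intro x hx
      obtain ⟨f, hf⟩ := maurey_c w M hM hw hm (Real.sqrt s) hL r hr G (fun _ => rfl)
        (fun _ _ _ _ => rfl) x (DD_l1 hx)
      exact ⟨f, Finset.mem_univ _, hf⟩)
  refine ⟨P, hP, hc.trans (le_of_eq ?_), fun x hx => ?_⟩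
  · simp only [Finset.card_univ, Fintype.card_pi, Fintype.card_option, Fintype.card_prod,
      Fintype.card_fin, Fintype.card_bool, Finset.prod_const]
    ring
  · obtain ⟨z, hz, f, _, h1, h2⟩ := hPx x hx
    refine ⟨z, hz, fun i => ?_⟩
    rw [qf_sub]
    have e : qf w i x - qf w i z = ((1 / (r : ℝ) : ℝ) * ∑ t, G i (f t) - qf w i z)
      - ((1 / (r : ℝ) : ℝ) * ∑ t, G i (f t) - qf w i x) := by ring
    rw [e]
    refine (norm_sub_le _ _).trans ((add_le_add (h2 i) (h1 i)).trans (le_of_eq ?_))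
    ring

lemma net {n s : ℕ} (hs : 1 ≤ s) (hsn : s ≤ n) :
    ∃ N : Finset (Fin n → ℂ), (∀ z ∈ N, z ∈ DD n s) ∧ N.card ≤ (17 * n) ^ (3 * s) ∧
      ∀ x ∈ DD n s, ∃ z ∈ N, (4 : ℂ) • (x - z) ∈ DD n s := by
  classical
  have hsR : (1:ℝ) ≤ s := by exact_mod_cast hs
  have hbox : ∀ t : ℝ, |t| ≤ 1 → ⌊8 * s * t⌋ ∈ Finset.Icc (-(8 * s : ℤ)) (8 * s) := by
    intro t ht
    rw [abs_le] at ht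
    rw [Finset.mem_Icc]
    constructor
    · apply Int.le_floor.2; push_cast; nlinarith
    · have : ⌊8 * s * t⌋ ≤ ⌊((8 * s : ℤ) : ℝ)⌋ := Int.floor_le_floor (by push_cast; nlinarith)
      rwa [Int.floor_intCast] at this
  have hfl : ∀ a b : ℝ, ⌊8 * s * a⌋ = ⌊8 * s * b⌋ → (a - b) ^ 2 ≤ 1 / (64 * s) := by
    intro a b hab
    have := Int.abs_sub_lt_one_of_floor_eq_floor hab
    have h2 : (8 * s * a - 8 * s * b) ^ 2 ≤ 1 := by
      rw [← sq_abs]; nlinarith [abs_nonneg (8 * s * a - 8 * s * b)]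
    rw [le_div_iff₀ (by positivity)]
    nlinarith [mul_nonneg (sq_nonneg (a - b)) (by linarith : (0:ℝ) ≤ s), mul_nonneg (mul_nonneg (sq_nonneg (a - b)) (by linarith : (0:ℝ) ≤ s)) (by linarith : (0:ℝ) ≤ s - 1)]
  have each : ∀ Γ : Finset (Fin n), ∃ N : Finset (Fin n → ℂ), Γ.card = s →
      ((∀ z ∈ N, z ∈ DD n s) ∧ N.card ≤ ((17 * n) ^ 2) ^ s ∧
      ∀ x ∈ DD n s, (∀ a, a ∉ Γ → x a = 0) → ∃ z ∈ N, (4 : ℂ) • (x - z) ∈ DD n s) := by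
    intro Γ
    by_cases hΓ : Γ.card = s
    swap
    · exact ⟨∅, fun h => absurd h hΓ⟩
    obtain ⟨N, hN, hc, hx⟩ := reps {x | x ∈ DD n s ∧ ∀ a, a ∉ Γ → x a = 0}
      (Fintype.piFinset fun _ : Γ => Finset.Icc (-(8 * s : ℤ)) (8 * s) ×ˢ Finset.Icc (-(8 * s : ℤ)) (8 * s))
      (fun x f => f = fun a : Γ => (⌊8 * s * (x a.1).re⌋, ⌊8 * s * (x a.1).im⌋)) (by
        rintro x ⟨hx, _⟩
        refine ⟨_, ?_, rfl⟩
        rw [Fintype.mem_piFinset]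
        intro a
        have h1 : ‖x a‖ ≤ 1 := by
          have h2 : ‖x a‖ ^ 2 ≤ 1 := (Finset.single_le_sum (f := fun a => ‖x a‖ ^ 2)
            (fun _ _ => sq_nonneg _) (Finset.mem_univ a.1)).trans hx.2
          nlinarith [norm_nonneg (x a)]
        rw [Finset.mem_product]
        exact ⟨hbox _ ((Complex.abs_re_le_norm _).trans h1), hbox _ ((Complex.abs_im_le_norm _).trans h1)⟩)
    refine ⟨N, fun _ => ⟨fun z hz => (hN z hz).1, hc.trans ?_, fun x hxD hxΓ => ?_⟩⟩
    · rw [Fintype.card_piFinset]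
      simp only [Finset.card_product, Int.card_Icc, Finset.prod_const, Finset.card_univ,
        Fintype.card_coe, hΓ]
      have : (8 * (s:ℤ) + 1 - -(8 * s)).toNat ≤ 17 * n := by omega
      rw [sq]
      exact Nat.pow_le_pow_left (Nat.mul_le_mul this this) s
    · obtain ⟨z, hz, f, _, h1, h2⟩ := hx x ⟨hxD, hxΓ⟩
      have hzΓ := (hN z hz).2
      refine ⟨z, hz, ⟨Γ, hΓ, fun a ha => by simp [hxΓ a ha, hzΓ a ha]⟩, ?_⟩
      have e : ∑ a, ‖((4:ℂ) • (x - z)) a‖ ^ 2 = ∑ a ∈ Γ, ‖((4:ℂ) • (x - z)) a‖ ^ 2 := by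
        symm
        refine Finset.sum_subset (Finset.subset_univ _) fun a _ ha => by simp [hxΓ a ha, hzΓ a ha]
      rw [e]
      calc _ ≤ ∑ a ∈ Γ, (1 / s : ℝ) := by
            refine Finset.sum_le_sum fun a ha => ?_
            have h3 := congrFun (h1.symm.trans h2) ⟨a, ha⟩
            simp only [Prod.mk.injEq] at h3
            have h4 := hfl _ _ h3.1
            have h5 := hfl _ _ h3.2
            have : ‖((4:ℂ) • (x - z)) a‖ ^ 2 = 16 * (((x a).re - (z a).re) ^ 2 + ((x a).im - (z a).im) ^ 2) := by
              simp only [Pi.smul_apply, Pi.sub_apply, smul_eq_mul, norm_mul, mul_pow]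
              rw [← Complex.normSq_eq_norm_sq (x a - z a), Complex.normSq_apply]
              simp; ring
            rw [this]
            have h6 : 1 / (64 * s : ℝ) = 1 / s / 64 := by field_simp
            rw [h6] at h4 h5
            have : (0:ℝ) ≤ 1 / s := by positivity
            linarith
        _ = 1 := by rw [Finset.sum_const, hΓ, nsmul_eq_mul]; field_simp
  choose NΓ hNΓ using each
  refine ⟨(Finset.powersetCard s Finset.univ).biUnion NΓ, ?_, ?_, ?_⟩
  · intro z hz
    rw [Finset.mem_biUnion] at hz
    obtain ⟨Γ, hΓ, hz⟩ := hz
    rw [Finset.mem_powersetCard] at hΓ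
    exact (hNΓ Γ hΓ.2).1 z hz
  · refine (Finset.card_biUnion_le_card_mul _ _ (((17 * n) ^ 2) ^ s) fun Γ hΓ => ?_).trans ?_
    · rw [Finset.mem_powersetCard] at hΓ
      exact (hNΓ Γ hΓ.2).2.1
    · rw [Finset.card_powersetCard, Finset.card_univ, Fintype.card_fin]
      calc _ ≤ (17 * n) ^ s * ((17 * n) ^ 2) ^ s := by
            gcongr
            exact (Nat.choose_le_pow n s).trans (Nat.pow_le_pow_left (by omega) s)
        _ = _ := by rw [← pow_mul, ← pow_add]; congr 1; ring
  · intro x hx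
    obtain ⟨Γ, hΓ, h0⟩ := hx.1
    obtain ⟨z, hz, h⟩ := (hNΓ Γ hΓ).2.2 x hx h0
    exact ⟨z, Finset.mem_biUnion.2 ⟨Γ, Finset.mem_powersetCard.2 ⟨Finset.subset_univ _, hΓ⟩, hz⟩, h⟩

lemma DD_zero {n s : ℕ} (hsn : s ≤ n) : (0 : Fin n → ℂ) ∈ DD n s := by
  obtain ⟨Γ, _, hΓ⟩ := Finset.exists_subset_card_eq (s := (Finset.univ : Finset (Fin n))) (n := s) (by simpa using hsn)
  exact ⟨⟨Γ, hΓ, fun _ _ => rfl⟩, by simp⟩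

lemma chain_data {m n s : ℕ} (w : Fin m → Fin n → ℂ) (M : ℝ) (hM : 0 ≤ M) (hw : ∀ i a, ‖w i a‖ ≤ M)
    (hm : 1 ≤ m) (hs : 1 ≤ s) (hsn : s ≤ n) (N : Finset (Fin n → ℂ)) (hN : ∀ z ∈ N, z ∈ DD n s)
    (hNc : N.card ≤ (17 * n) ^ (3 * s)) (J : ℕ) (hJ0 : 1 ≤ J) (hJ : 3 * s ≤ 4 ^ J) (A : ℝ)
    (hA : A = 24 * M * Real.sqrt s * Real.sqrt (Real.log (4 * m))) :
    ∃ (P : ℕ → Finset (Fin n → ℂ)) (π : ℕ → (Fin n → ℂ) → (Fin n → ℂ)),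
      (∀ k ≤ J, (P k).card ≤ (17 * n) ^ (4 ^ k)) ∧ (∀ k ≤ J, ∀ z ∈ P k, z ∈ DD n s) ∧
      ∀ x ∈ N, π 0 x = 0 ∧ π J x = x ∧
        ∀ k ≤ J, π k x ∈ P k ∧ ∀ i, ‖qf w i (x - π k x)‖ ≤ A / 2 ^ k := by
  classical
  have hnet := fun k : ℕ => maurey_net (n := n) (s := s) w M hM hw hm hs (4 ^ k) (by positivity)
  choose P0 hP0 hP0c hP0x using hnet
  have : ∀ (k : ℕ) (x : Fin n → ℂ), ∃ z, x ∈ DD n s → z ∈ P0 k ∧ ∀ i, ‖qf w i (x - z)‖ ≤ A / 2 ^ k := by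
    intro k x
    by_cases hx : x ∈ DD n s
    · obtain ⟨z, hz, hz2⟩ := hP0x k x hx
      refine ⟨z, fun _ => ⟨hz, fun i => (hz2 i).trans (le_of_eq ?_)⟩⟩
      rw [hA]
      congr 1
      rw [Nat.cast_pow, show ((4:ℕ):ℝ) = 2 ^ 2 by norm_num, ← pow_mul, mul_comm 2 k, pow_mul]
      exact Real.sqrt_sq (by positivity)
    · exact ⟨0, fun h => absurd h hx⟩
  choose π0 hπ0 using this
  have hn : 1 ≤ 17 * n := by omega
  have hlog1 : 1 ≤ Real.sqrt (Real.log (4 * m)) := by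
    rw [Real.one_le_sqrt, Real.le_log_iff_exp_le (by positivity)]
    have : (1:ℝ) ≤ m := by exact_mod_cast hm
    have := Real.exp_one_lt_d9
    linarith
  have hMs : 0 ≤ M * Real.sqrt s := by positivity
  have hA1 : M * Real.sqrt s ≤ A := by
    rw [hA]; nlinarith
  refine ⟨fun k => if k = 0 then {0} else if k = J then N else P0 k,
    fun k x => if k = 0 then 0 else if k = J then x else π0 k x, ?_, ?_, ?_⟩
  · intro k hk
    dsimp only
    split_ifs with h1 h2
    · simpa using Nat.one_le_pow _ _ hn
    · rw [h2]; exact hNc.trans (Nat.pow_le_pow_right hn hJ)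
    · exact (hP0c k).trans (Nat.pow_le_pow_left (by omega) _)
  · intro k hk z
    dsimp only
    split_ifs with h1 h2
    · intro hz
      rw [Finset.mem_singleton.1 hz]; exact DD_zero hsn
    · exact hN z
    · exact hP0 k z
  · intro x hx
    refine ⟨by simp, by simp [show J ≠ 0 by omega], fun k hk => ?_⟩
    dsimp only
    split_ifs with h1 h2
    · refine ⟨by simp, fun i => ?_⟩
      rw [h1, sub_zero, pow_zero, div_one]
      refine le_trans ?_ hA1
      exact (qf_le hw i x).trans (mul_le_mul_of_nonneg_left (DD_l1 (hN x hx)) hM)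
    · refine ⟨hx, fun i => ?_⟩
      rw [sub_self, qf_zero, norm_zero]
      have := hMs.trans hA1
      positivity
    · exact hπ0 k x (hN x hx)

lemma DD_coord {n s : ℕ} {x : Fin n → ℂ} (hx : ∑ a, ‖x a‖ ^ 2 ≤ 1) (a : Fin n) : ‖x a‖ ≤ 1 := by
  have h2 : ‖x a‖ ^ 2 ≤ 1 := (Finset.single_le_sum (f := fun a => ‖x a‖ ^ 2)
    (fun _ _ => sq_nonneg _) (Finset.mem_univ a)).trans hx
  nlinarith [norm_nonneg (x a)]

lemma form_bdd {n : ℕ} (A : Matrix (Fin n) (Fin n) ℂ) (x y : Fin n → ℂ)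
    (hx : ∑ a, ‖x a‖ ^ 2 ≤ 1) (hy : ∑ a, ‖y a‖ ^ 2 ≤ 1) :
    ‖dotProduct (star y) (A.mulVec x)‖ ≤ ∑ a, ∑ b, ‖A a b‖ := by
  rw [dotProduct]
  refine (norm_sum_le _ _).trans (Finset.sum_le_sum fun a _ => ?_)
  rw [norm_mul, mulVec, dotProduct, Pi.star_apply, norm_star]
  have h1 : ‖∑ b, A a b * x b‖ ≤ ∑ b, ‖A a b‖ := by
    refine (norm_sum_le _ _).trans (Finset.sum_le_sum fun b _ => ?_)
    rw [norm_mul]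
    exact mul_le_of_le_one_right (norm_nonneg _) (DD_coord (s := 0) hx b)
  calc _ ≤ 1 * ‖∑ b, A a b * x b‖ := by gcongr; exact DD_coord (s := 0) hy a
    _ ≤ _ := by simpa using h1

lemma snorm_nonneg {n : ℕ} (s : ℕ) (A : Matrix (Fin n) (Fin n) ℂ) : 0 ≤ snormS s A := by
  apply Real.sSup_nonneg
  rintro r ⟨Γ, x, y, _, _, _, _, _, rfl⟩
  exact norm_nonneg _

lemma form_eq {m n : ℕ} (u v : Fin m → Fin n → ℂ) (c : Fin m → ℂ) (x y : Fin n → ℂ) :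
    dotProduct (star y) ((∑ i, c i • Matrix.vecMulVec (u i) (star (v i))).mulVec x)
      = ∑ i, c i * (star (qf u i y) * qf v i x) := by
  rw [Matrix.sum_mulVec, dotProduct_sum]
  refine Finset.sum_congr rfl fun i _ => ?_
  rw [smul_mulVec, dotProduct_smul, smul_eq_mul]
  congr 1
  simp only [dotProduct, mulVec, vecMulVec_apply, qf, Pi.star_apply, star_sum, star_mul', star_star]
  rw [Finset.sum_mul]
  refine Finset.sum_congr rfl fun a _ => ?_
  rw [Finset.mul_sum, Finset.mul_sum]
  refine Finset.sum_congr rfl fun b _ => ?_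
  ring

lemma quad_le {m n s : ℕ} (v : Fin m → Fin n → ℂ) (x : Fin n → ℂ) (hx : x ∈ DD n s) :
    ∑ i, ‖qf v i x‖ ^ 2 ≤ snormS s (∑ i, Matrix.vecMulVec (v i) (star (v i))) := by
  obtain ⟨⟨Γ, hΓ, h0⟩, h1⟩ := hx
  set q := ∑ a, ‖x a‖ ^ 2 with hq
  have hq0 : 0 ≤ q := Finset.sum_nonneg fun _ _ => sq_nonneg _
  have hsn := snorm_nonneg s (∑ i, Matrix.vecMulVec (v i) (star (v i)))
  rcases hq0.eq_or_lt with hz | hqp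
  · have : x = 0 := by
      funext a
      have := (Finset.sum_eq_zero_iff_of_nonneg (fun a _ => sq_nonneg ‖x a‖)).1 hz.symm a (Finset.mem_univ a)
      simpa using this
    simpa [this, qf_zero] using hsn
  set t := Real.sqrt q with ht
  have htp : 0 < t := Real.sqrt_pos.2 hqp
  have htt : t ^ 2 = q := Real.sq_sqrt hq0
  set x' : Fin n → ℂ := ((1 / t : ℝ) : ℂ) • x with hx'
  have hx'1 : ∑ a, ‖x' a‖ ^ 2 = 1 := by
    simp only [hx', Pi.smul_apply, smul_eq_mul, norm_mul, mul_pow, ← Finset.mul_sum, Complex.norm_real,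
      Real.norm_eq_abs, sq_abs]
    rw [← hq, ← htt]; field_simp
  have hmem : ∑ i, ‖qf v i x'‖ ^ 2 ≤ snormS s (∑ i, Matrix.vecMulVec (v i) (star (v i))) := by
    apply le_csSup
    · refine ⟨∑ a, ∑ b, ‖(∑ i, Matrix.vecMulVec (v i) (star (v i))) a b‖, ?_⟩
      rintro r ⟨Γ, x, y, _, _, _, hx, hy, rfl⟩
      exact form_bdd _ x y hx.le hy.le
    · refine ⟨Γ, x', x', hΓ.le, fun a ha => by simp [hx', h0 a ha], fun a ha => by simp [hx', h0 a ha],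
        hx'1, hx'1, ?_⟩
      have := form_eq v v (fun _ => 1) x' x'
      simp only [one_smul, one_mul] at this
      rw [this]
      have h2 : ∑ i, star (qf v i x') * qf v i x' = ((∑ i, ‖qf v i x'‖ ^ 2 : ℝ) : ℂ) := by
        push_cast
        refine Finset.sum_congr rfl fun i _ => ?_
        exact Complex.conj_mul' _
      rw [h2, Complex.norm_real, Real.norm_eq_abs, abs_of_nonneg (Finset.sum_nonneg fun _ _ => sq_nonneg _)]
  have hxe : ∀ i, ‖qf v i x‖ ^ 2 = q * ‖qf v i x'‖ ^ 2 := by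
    intro i
    rw [hx', qf_smul, norm_mul, mul_pow, Complex.norm_real, Real.norm_eq_abs, sq_abs, ← htt]
    field_simp
  simp_rw [hxe]
  rw [← Finset.mul_sum]
  have : 0 ≤ ∑ i, ‖qf v i x'‖ ^ 2 := Finset.sum_nonneg fun _ _ => sq_nonneg _
  nlinarith

lemma snorm_net {n s : ℕ} (hsn : s ≤ n) (A : Matrix (Fin n) (Fin n) ℂ)
    (N : Finset (Fin n → ℂ)) (hN : ∀ z ∈ N, z ∈ DD n s)
    (hNx : ∀ x ∈ DD n s, ∃ z ∈ N, (4 : ℂ) • (x - z) ∈ DD n s) (B : ℝ)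
    (hB : ∀ x ∈ N, ∀ y ∈ N, ‖dotProduct (star y) (A.mulVec x)‖ ≤ B) : snormS s A ≤ 2 * B := by
  set T : Set ℝ := {r | ∃ x ∈ DD n s, ∃ y ∈ DD n s, r = ‖dotProduct (star y) (A.mulVec x)‖} with hT
  have hbd : BddAbove T := by
    refine ⟨∑ a, ∑ b, ‖A a b‖, ?_⟩
    rintro r ⟨x, hx, y, hy, rfl⟩
    exact form_bdd A x y hx.2 hy.2
  have hle : ∀ x ∈ DD n s, ∀ y ∈ DD n s, ‖dotProduct (star y) (A.mulVec x)‖ ≤ sSup T :=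
    fun x hx y hy => le_csSup hbd ⟨x, hx, y, hy, rfl⟩
  have hTB : sSup T ≤ B + sSup T / 2 := by
    refine csSup_le ⟨_, 0, DD_zero hsn, 0, DD_zero hsn, rfl⟩ ?_
    rintro r ⟨x, hx, y, hy, rfl⟩
    obtain ⟨x0, hx0, hx1⟩ := hNx x hx
    obtain ⟨y0, hy0, hy1⟩ := hNx y hy
    have e : dotProduct (star y) (A.mulVec x) = dotProduct (star y0) (A.mulVec x0) +
      (1 / 4) * dotProduct (star y0) (A.mulVec ((4 : ℂ) • (x - x0))) +
      (1 / 4) * dotProduct (star ((4 : ℂ) • (y - y0))) (A.mulVec x) := by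
      have h4 : star ((4 : ℂ) • (y - y0)) = (4:ℂ) • (star y - star y0) := by
        ext a; simp
      rw [h4, mulVec_smul, dotProduct_smul, smul_dotProduct, mulVec_sub, dotProduct_sub, sub_dotProduct]
      simp only [smul_eq_mul]; ring
    rw [e]
    have n4 : ‖(1 / 4 : ℂ)‖ = 1 / 4 := by simp
    have h1 := hB x0 hx0 y0 hy0
    have h2 := hle _ hx1 _ (hN y0 hy0)
    have h3 := hle _ hx _ hy1
    refine (norm_add₃_le).trans ?_
    rw [norm_mul, norm_mul, n4]
    linarith
  have hfin : snormS s A ≤ sSup T := by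
    rcases Set.eq_empty_or_nonempty {r : ℝ | ∃ (Γ : Finset (Fin n)) (x y : Fin n → ℂ),
      Γ.card ≤ s ∧ (∀ i, i ∉ Γ → x i = 0) ∧ (∀ i, i ∉ Γ → y i = 0) ∧
      (∑ i, ‖x i‖ ^ 2) = 1 ∧ (∑ i, ‖y i‖ ^ 2) = 1 ∧
      r = ‖dotProduct (star y) (A.mulVec x)‖} with he | hne
    · rw [snormS, he, Real.sSup_empty]
      exact (norm_nonneg _).trans (hle 0 (DD_zero hsn) 0 (DD_zero hsn))
    · refine csSup_le hne ?_
      rintro r ⟨Γ, x, y, hΓ, hx0, hy0, hx, hy, rfl⟩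
      obtain ⟨Γ', hsub, hΓ'⟩ := Finset.exists_superset_card_eq hΓ (by simpa using hsn)
      exact hle x ⟨⟨Γ', hΓ', fun a ha => hx0 a fun h => ha (hsub h)⟩, hx.le⟩
        y ⟨⟨Γ', hΓ', fun a ha => hy0 a fun h => ha (hsub h)⟩, hy.le⟩
  linarith

lemma snorm_big {n s : ℕ} (hsn : n ≤ s) (A : Matrix (Fin n) (Fin n) ℂ) : snormS s A = snormS n A := by
  have : ∀ Γ : Finset (Fin n), Γ.card ≤ n := fun Γ => by simpa using Finset.card_le_univ Γ
  unfold snormS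
  congr 1
  ext r
  constructor
  · rintro ⟨Γ, x, y, _, h⟩
    exact ⟨Γ, x, y, this Γ, h⟩
  · rintro ⟨Γ, x, y, _, h⟩
    exact ⟨Γ, x, y, (this Γ).trans hsn, h⟩

/-- coefficient vector -/
noncomputable def cf {m n : ℕ} (u v : Fin m → Fin n → ℂ) (x y : Fin n → ℂ) : Fin m → ℂ :=
  fun i => star (qf u i y) * qf v i x

lemma cf_diff {m n s : ℕ} (u v : Fin m → Fin n → ℂ) (x x' y y' : Fin n → ℂ)
    (hx : x ∈ DD n s) (hy' : y' ∈ DD n s) (D : ℝ) (hD : 0 ≤ D)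
    (h1 : ∀ i, ‖qf v i (x' - x)‖ ≤ D) (h2 : ∀ i, ‖qf u i (y' - y)‖ ≤ D) :
    ∑ i, ‖(cf u v x' y' - cf u v x y) i‖ ^ 2 ≤
      (2 * D * (Real.sqrt (snormS s (∑ i, Matrix.vecMulVec (v i) (star (v i)))) +
         Real.sqrt (snormS s (∑ i, Matrix.vecMulVec (u i) (star (u i)))))) ^ 2 := by
  have hV := quad_le v x hx
  have hU := quad_le u y' hy'
  have hV0 := snorm_nonneg s (∑ i, Matrix.vecMulVec (v i) (star (v i)))
  have hU0 := snorm_nonneg s (∑ i, Matrix.vecMulVec (u i) (star (u i)))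
  set a := Real.sqrt (snormS s (∑ i, Matrix.vecMulVec (v i) (star (v i)))) with ha
  set b := Real.sqrt (snormS s (∑ i, Matrix.vecMulVec (u i) (star (u i)))) with hb
  rw [← Real.sq_sqrt hV0, ← ha] at hV
  rw [← Real.sq_sqrt hU0, ← hb] at hU
  have ha0 : 0 ≤ a := Real.sqrt_nonneg _
  have hb0 : 0 ≤ b := Real.sqrt_nonneg _
  calc _ ≤ ∑ i, (2 * D ^ 2 * ‖qf u i y'‖ ^ 2 + 2 * D ^ 2 * ‖qf v i x‖ ^ 2) := by
        refine Finset.sum_le_sum fun i _ => ?_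
        have e : (cf u v x' y' - cf u v x y) i = star (qf u i y') * qf v i (x' - x)
          + star (qf u i (y' - y)) * qf v i x := by
          simp only [cf, Pi.sub_apply, qf_sub, star_sub]; ring
        rw [e]
        have h3 : ‖star (qf u i y') * qf v i (x' - x) + star (qf u i (y' - y)) * qf v i x‖
          ≤ ‖qf u i y'‖ * D + D * ‖qf v i x‖ := by
          refine (norm_add_le _ _).trans ?_
          rw [norm_mul, norm_mul, norm_star, norm_star]
          gcongr
          · exact h1 i
          · exact h2 i
        have h4 := pow_le_pow_left₀ (norm_nonneg _) h3 2
        nlinarith [sq_nonneg (‖qf u i y'‖ * D - D * ‖qf v i x‖)]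
    _ = 2 * D ^ 2 * ∑ i, ‖qf u i y'‖ ^ 2 + 2 * D ^ 2 * ∑ i, ‖qf v i x‖ ^ 2 := by
        rw [Finset.sum_add_distrib, Finset.mul_sum, Finset.mul_sum]
    _ ≤ 2 * D ^ 2 * b ^ 2 + 2 * D ^ 2 * a ^ 2 := by gcongr
    _ ≤ _ := by
        have hab : 0 ≤ a * b := mul_nonneg ha0 hb0
        have h5 : a ^ 2 + b ^ 2 ≤ (a + b) ^ 2 := by nlinarith
        have h6 := mul_le_mul_of_nonneg_left h5 (sq_nonneg D)
        nlinarith [mul_nonneg (sq_nonneg D) (sq_nonneg (a + b))]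

lemma main_le {m n s : ℕ} (u v : Fin m → Fin n → ℂ) (M : ℝ) (hM : 0 ≤ M)
    (hu : ∀ i a, ‖u i a‖ ≤ M) (hv : ∀ i a, ‖v i a‖ ≤ M)
    (hm : 1 ≤ m) (hs : 1 ≤ s) (hsn : s ≤ n) (J : ℕ) (hJ0 : 1 ≤ J) (hJ : 3 * s ≤ 4 ^ J) (A R : ℝ)
    (hA : A = 24 * M * Real.sqrt s * Real.sqrt (Real.log (4 * m)))
    (hR : R = Real.sqrt (snormS s (∑ i, Matrix.vecMulVec (v i) (star (v i)))) +
         Real.sqrt (snormS s (∑ i, Matrix.vecMulVec (u i) (star (u i))))) :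
    (∑ σ : Fin m → Bool, snormS s (∑ i, (sg σ i : ℂ) • Matrix.vecMulVec (u i) (star (v i)))) / 2 ^ m
      ≤ 256 * J * A * R * Real.sqrt (Real.log (17 * n)) := by
  classical
  obtain ⟨N, hN, hNc, hNx⟩ := net hs hsn
  obtain ⟨P, π, hPc, hPD, hπ⟩ := chain_data v M hM hv hm hs hsn N hN hNc J hJ0 hJ A hA
  obtain ⟨Q, ρ, hQc, hQD, hρ⟩ := chain_data u M hM hu hm hs hsn N hN hNc J hJ0 hJ A hA
  have hA0 : 0 ≤ A := by rw [hA]; positivity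
  have hR0 : 0 ≤ R := by rw [hR]; positivity
  have hn1 : 1 ≤ n := hs.trans hsn
  have hnR : (1:ℝ) ≤ n := by exact_mod_cast hn1
  have hlog0 : 0 ≤ Real.log (17 * n) := Real.log_nonneg (by linarith)
  have level : ∀ k : ℕ, ∃ g : (Fin m → Bool) → ℝ, k < J →
      (∀ σ, ∀ x ∈ N, ∀ y ∈ N, ‖∑ i, (sg σ i : ℂ) *
        (cf u v (π (k + 1) x) (ρ (k + 1) y) - cf u v (π k x) (ρ k y)) i‖ ≤ g σ) ∧
      (∑ σ, g σ) / 2 ^ m ≤ 128 * A * R * Real.sqrt (Real.log (17 * n)) := by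
    intro k
    by_cases hk : k < J
    swap
    · exact ⟨fun _ => 0, fun h => absurd h hk⟩
    let F : Finset (Fin m → ℂ) := (((P (k + 1) ×ˢ P k) ×ˢ (Q (k + 1) ×ˢ Q k)).filter
      (fun t => (∀ i, ‖qf v i (t.1.1 - t.1.2)‖ ≤ 2 * (A / 2 ^ k)) ∧
        ∀ i, ‖qf u i (t.2.1 - t.2.2)‖ ≤ 2 * (A / 2 ^ k))).image
      (fun t => cf u v t.1.1 t.2.1 - cf u v t.1.2 t.2.2)
    have hFc : F.card ≤ (17 * n) ^ (4 ^ (k + 2)) := by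
      refine Finset.card_image_le.trans ((Finset.card_filter_le _ _).trans ?_)
      rw [Finset.card_product, Finset.card_product, Finset.card_product]
      have h17 : 0 < 17 * n := by omega
      have hkk : (17 * n) ^ (4 ^ k) ≤ (17 * n) ^ (4 ^ (k + 1)) :=
        Nat.pow_le_pow_right h17 (Nat.pow_le_pow_right (by norm_num) (by omega))
      calc _ ≤ ((17 * n) ^ (4 ^ (k + 1)) * (17 * n) ^ (4 ^ (k + 1))) *
            ((17 * n) ^ (4 ^ (k + 1)) * (17 * n) ^ (4 ^ (k + 1))) := by
            refine Nat.mul_le_mul (Nat.mul_le_mul ?_ ?_) (Nat.mul_le_mul ?_ ?_)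
            · exact hPc _ hk
            · exact (hPc _ hk.le).trans hkk
            · exact hQc _ hk
            · exact (hQc _ hk.le).trans hkk
        _ = _ := by rw [← pow_add, ← pow_add]; congr 1; ring
    obtain ⟨g, hg1, hg2⟩ := emax F (2 * (2 * (A / 2 ^ k)) * R) ((17 * n : ℝ) ^ (4 ^ (k + 2)))
      (by positivity) (one_le_pow₀ (by linarith)) (by exact_mod_cast hFc) (by
        intro c hc
        simp only [F, Finset.mem_image, Finset.mem_filter, Finset.mem_product] at hc
        obtain ⟨⟨⟨x', x⟩, ⟨y', y⟩⟩, ⟨⟨⟨hx', hx⟩, hy', hy⟩, h1, h2⟩, rfl⟩ := hc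
        rw [hR]
        exact cf_diff u v x x' y y' (hPD k hk.le x hx) (hQD (k + 1) hk y' hy') _ (by positivity) h1 h2)
    refine ⟨g, fun _ => ⟨fun σ x hx y hy => hg1 σ _ ?_, hg2.trans ?_⟩⟩
    · have hdiff : ∀ (w : Fin m → Fin n → ℂ) (z a b : Fin n → ℂ) (i : Fin m),
          ‖qf w i (z - a)‖ ≤ A / 2 ^ (k + 1) → ‖qf w i (z - b)‖ ≤ A / 2 ^ k →
          ‖qf w i (a - b)‖ ≤ 2 * (A / 2 ^ k) := by
        intro w z a b i h1 h2
        have e : qf w i (a - b) = qf w i (z - b) - qf w i (z - a) := by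
          simp only [qf_sub]; ring
        rw [e]
        refine (norm_sub_le _ _).trans ?_
        have : A / 2 ^ (k + 1) ≤ A / 2 ^ k := by
          gcongr
          · norm_num
          · omega
        linarith
      have hx1 := (hπ x hx).2.2 (k + 1) hk
      have hx2 := (hπ x hx).2.2 k hk.le
      have hy1 := (hρ y hy).2.2 (k + 1) hk
      have hy2 := (hρ y hy).2.2 k hk.le
      simp only [F, Finset.mem_image, Finset.mem_filter, Finset.mem_product]
      exact ⟨((π (k + 1) x, π k x), (ρ (k + 1) y, ρ k y)),
        ⟨⟨⟨hx1.1, hx2.1⟩, hy1.1, hy2.1⟩, fun i => hdiff v x _ _ i (hx1.2 i) (hx2.2 i),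
          fun i => hdiff u y _ _ i (hy1.2 i) (hy2.2 i)⟩, rfl⟩
    · have hsq : Real.sqrt (Real.log (4 * (17 * n : ℝ) ^ (4 ^ (k + 2)))) ≤
          2 ^ (k + 3) * Real.sqrt (Real.log (17 * n)) := by
        have h4 : 4 * (17 * n : ℝ) ^ (4 ^ (k + 2)) ≤ (17 * n : ℝ) ^ (4 ^ (k + 3)) := by
          calc 4 * (17 * n : ℝ) ^ (4 ^ (k + 2)) ≤ (17 * n) * (17 * n : ℝ) ^ (4 ^ (k + 2)) := by
                gcongr; linarith
            _ = (17 * n : ℝ) ^ (4 ^ (k + 2) + 1) := by rw [pow_succ]; ring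
            _ ≤ _ := by
                apply pow_le_pow_right₀ (by linarith)
                have : 1 ≤ 4 ^ (k + 2) := Nat.one_le_pow _ _ (by norm_num)
                rw [pow_succ 4 (k + 2)]; omega
        have h5 := Real.log_le_log (by positivity) h4
        rw [Real.log_pow] at h5
        refine (Real.sqrt_le_sqrt h5).trans (le_of_eq ?_)
        rw [Real.sqrt_mul (by positivity)]
        congr 1
        rw [Nat.cast_pow, show ((4:ℕ):ℝ) = 2 ^ 2 by norm_num, ← pow_mul, mul_comm 2, pow_mul]
        exact Real.sqrt_sq (by positivity)
      calc _ ≤ 4 * (2 * (2 * (A / 2 ^ k)) * R) * (2 ^ (k + 3) * Real.sqrt (Real.log (17 * n))) := by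
            gcongr
        _ = _ := by rw [pow_add]; field_simp; ring
  choose g hg using level
  have hpt : ∀ σ : Fin m → Bool, snormS s (∑ i, (sg σ i : ℂ) • Matrix.vecMulVec (u i) (star (v i)))
      ≤ 2 * ∑ k ∈ Finset.range J, g k σ := by
    intro σ
    refine snorm_net hsn _ N hN hNx _ fun x hx y hy => ?_
    rw [form_eq]
    have tel : ∑ i, (sg σ i : ℂ) * (star (qf u i y) * qf v i x) =
        ∑ k ∈ Finset.range J, ∑ i, (sg σ i : ℂ) *
        (cf u v (π (k + 1) x) (ρ (k + 1) y) - cf u v (π k x) (ρ k y)) i := by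
      have e := Finset.sum_range_sub (fun k => ∑ i, (sg σ i : ℂ) * cf u v (π k x) (ρ k y) i) J
      rw [(hπ x hx).2.1, (hρ y hy).2.1, (hπ x hx).1, (hρ y hy).1] at e
      simp only [cf, qf_zero, mul_zero, Finset.sum_const_zero, sub_zero] at e
      rw [← e]
      refine Finset.sum_congr rfl fun k _ => ?_
      rw [← Finset.sum_sub_distrib]
      refine Finset.sum_congr rfl fun i _ => ?_
      simp only [cf, Pi.sub_apply]; ring
    rw [tel]
    refine (norm_sum_le _ _).trans (Finset.sum_le_sum fun k hk => ?_)
    exact (hg k (Finset.mem_range.1 hk)).1 σ x hx y hy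
  calc _ ≤ (∑ σ : Fin m → Bool, 2 * ∑ k ∈ Finset.range J, g k σ) / 2 ^ m := by
        gcongr with σ _; exact hpt σ
    _ = 2 * ∑ k ∈ Finset.range J, (∑ σ, g k σ) / 2 ^ m := by
        rw [← Finset.mul_sum, Finset.sum_comm, mul_div_assoc, Finset.sum_div]
    _ ≤ 2 * ∑ k ∈ Finset.range J, 128 * A * R * Real.sqrt (Real.log (17 * n)) := by
        gcongr with k hk
        exact (hg k (Finset.mem_range.1 hk)).2
    _ = _ := by rw [Finset.sum_const, Finset.card_range, nsmul_eq_mul]; ring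

lemma main_small {m n s : ℕ} (u v : Fin m → Fin n → ℂ) (M : ℝ) (hM : 0 ≤ M)
    (hu : ∀ i a, ‖u i a‖ ≤ M) (hv : ∀ i a, ‖v i a‖ ≤ M)
    (hn : 2 ≤ n) (hm : 2 ≤ m) (hs : 2 ≤ s) (hsn : s ≤ n) :
    (∑ σ : Fin m → Bool, snormS s (∑ i, (sg σ i : ℂ) • Matrix.vecMulVec (u i) (star (v i)))) / 2 ^ m
      ≤ 184320 * M * Real.sqrt s * Real.log s * Real.sqrt (Real.log m * Real.log n) *
        (Real.sqrt (snormS s (∑ i, Matrix.vecMulVec (v i) (star (v i)))) +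
         Real.sqrt (snormS s (∑ i, Matrix.vecMulVec (u i) (star (u i))))) := by
  set R := Real.sqrt (snormS s (∑ i, Matrix.vecMulVec (v i) (star (v i)))) +
         Real.sqrt (snormS s (∑ i, Matrix.vecMulVec (u i) (star (u i)))) with hR
  have hR0 : 0 ≤ R := by rw [hR]; positivity
  have hmR : (2:ℝ) ≤ m := by exact_mod_cast hm
  have hnR : (2:ℝ) ≤ n := by exact_mod_cast hn
  have hsR : (2:ℝ) ≤ s := by exact_mod_cast hs
  have hl2 : Real.log s = Real.log s := rfl
  have hlt : s < 2 ^ (Nat.log 2 s + 1) := Nat.lt_pow_succ_log_self (by norm_num) s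
  refine (main_le u v M hM hu hv (by omega) (by omega) hsn (Nat.log 2 s + 2) (by omega) ?_ _ R rfl hR).trans ?_
  · have h4 : 4 ^ (Nat.log 2 s + 2) = 4 * (2 ^ (Nat.log 2 s + 1) * 2 ^ (Nat.log 2 s + 1)) := by
      rw [← pow_add, show (4:ℕ) = 2 ^ 2 by norm_num, ← pow_mul, ← pow_add]; congr 1; ring
    rw [h4]; nlinarith
  have hJ : ((Nat.log 2 s + 2 : ℕ) : ℝ) ≤ 6 * Real.log s := by
    have h1 : 1 ≤ Nat.log 2 s := Nat.log_pos (by norm_num) hs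
    have h2 : 2 ^ Nat.log 2 s ≤ s := Nat.pow_log_le_self 2 (by omega)
    have h3 : (2:ℝ) ^ Nat.log 2 s ≤ s := by exact_mod_cast h2
    have h4 := Real.log_le_log (by positivity) h3
    rw [Real.log_pow] at h4
    have h5 := Real.log_two_gt_d9
    have h6 : (1:ℝ) ≤ Nat.log 2 s := by exact_mod_cast h1
    push_cast
    nlinarith
  have hlogs : 0 ≤ Real.log s := Real.log_nonneg (by linarith)
  have hlogm : 0 ≤ Real.log m := Real.log_nonneg (by linarith)
  have hlogn : 0 ≤ Real.log n := Real.log_nonneg (by linarith)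
  have h4m : Real.log (4 * m) ≤ 3 * Real.log m := by
    rw [show 3 * Real.log (m:ℝ) = Real.log ((m:ℝ) ^ 3) by rw [Real.log_pow]; norm_num]
    apply Real.log_le_log (by positivity)
    nlinarith [mul_nonneg (by linarith : (0:ℝ) ≤ m) (by nlinarith : (0:ℝ) ≤ (m:ℝ) ^ 2 - 4)]
  have h17n : Real.log (17 * n) ≤ 6 * Real.log n := by
    rw [show 6 * Real.log (n:ℝ) = Real.log ((n:ℝ) ^ 6) by rw [Real.log_pow]; norm_num]
    apply Real.log_le_log (by positivity)
    have h5 : (2:ℝ) ^ 5 ≤ (n:ℝ) ^ 5 := by gcongr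
    calc 17 * (n:ℝ) ≤ (n:ℝ) ^ 5 * n := by gcongr; linarith
      _ = _ := by ring
  have hsq : Real.sqrt (Real.log (4 * m)) * Real.sqrt (Real.log (17 * n)) ≤
      5 * Real.sqrt (Real.log m * Real.log n) := by
    rw [← Real.sqrt_mul (Real.log_nonneg (by linarith))]
    rw [show (5:ℝ) = Real.sqrt (5 ^ 2) by rw [Real.sqrt_sq (by norm_num)], ← Real.sqrt_mul (by positivity)]
    apply Real.sqrt_le_sqrt
    calc _ ≤ (3 * Real.log m) * (6 * Real.log n) :=
          mul_le_mul h4m h17n (Real.log_nonneg (by linarith)) (by positivity)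
      _ ≤ _ := by nlinarith [mul_nonneg hlogm hlogn]
  calc _ = 6144 * M * Real.sqrt s * R * (((Nat.log 2 s + 2 : ℕ) : ℝ) *
        (Real.sqrt (Real.log (4 * m)) * Real.sqrt (Real.log (17 * n)))) := by ring
    _ ≤ 6144 * M * Real.sqrt s * R * ((6 * Real.log s) * (5 * Real.sqrt (Real.log m * Real.log n))) := by
        gcongr
    _ = _ := by ring

theorem stmt8 : ∃ C : ℝ, 0 < C ∧
    ∀ (n m s : ℕ) (M : ℝ) (u v : Fin m → Fin n → ℂ), 2 ≤ n → 2 ≤ m → 2 ≤ s →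
    (∀ i, ∀ a, ‖u i a‖ ≤ M) →
    (∀ i, ∀ a, ‖v i a‖ ≤ M) →
    (∫ ε, snormS s (∑ i, (ε i : ℂ) • Matrix.vecMulVec (u i) (star (v i)))
        ∂(rademacherPi m))
      ≤ C * M * Real.sqrt s * Real.log s * Real.sqrt (Real.log m * Real.log n) *
        (Real.sqrt (snormS s (∑ i, Matrix.vecMulVec (v i) (star (v i)))) +
         Real.sqrt (snormS s (∑ i, Matrix.vecMulVec (u i) (star (u i))))) := by
  refine ⟨184320, by norm_num, ?_⟩
  intro n m s M u v hn hm hs hu hv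
  have hM : 0 ≤ M := (norm_nonneg _).trans (hu ⟨0, by omega⟩ ⟨0, by omega⟩)
  rw [integral_rad m (fun ε => snormS s (∑ i, (ε i : ℂ) • Matrix.vecMulVec (u i) (star (v i))))]
  rcases le_total s n with hsn | hsn
  · exact main_small u v M hM hu hv hn hm hs hsn
  · simp only [snorm_big hsn]
    refine (main_small u v M hM hu hv hn hm hn le_rfl).trans ?_
    have hnR : (2:ℝ) ≤ n := by exact_mod_cast hn
    have hsR : (n:ℝ) ≤ s := by exact_mod_cast hsn
    have : 0 ≤ Real.log n := Real.log_nonneg (by linarith)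
    gcongr
end
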